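/- First Sampling Lemma: let F be a convergence determining sequence, let U, W ∈ 𝒲₁ be probability-graphons, let k ∈ ℕ*, and let X = (X₁,…,X_k) be a random vector uniformly distributed on [0,1]^k. Then with probability at least 1 − 4 k^{1/4} e^{−√k/10} one has −2/k^{1/4} ≤ ‖U_X − W_X‖_{□,F} − ‖U − W‖_{□,F} ≤ 9/k^{1/4}. -/

import Mathlib

open MeasureTheory Filter Topology
open scoped ENNReal NNReal

noncomputable section

namespace PG

/-- The unit square `[0,1]²`, with its product Lebesgue measure. -/
abbrev Sq : Type := unitInterval × unitInterval

variable {Z : Type*} [MeasurableSpace Z] [TopologicalSpace Z]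

/-! ### Measure-valued kernels and probability-graphons -/

/-- `W(A;·) = ∫_A W(x,y;·) dx dy` for a measure-valued kernel. -/
def kernelInt (W : Sq → Measure Z) (A : Set Sq) : Measure Z :=
  ((volume : Measure Sq).restrict A).bind W

/-- The measure `M_W = W([0,1]²;·)` associated with a (positive) measure-valued kernel. -/
def MW (W : Sq → Measure Z) : Measure Z := (volume : Measure Sq).bind W

/-- A probability-graphon: a measurable map from `[0,1]²` to probability measures on `Z`. -/
def IsProbGraphon (W : Sq → Measure Z) : Prop :=
  (∀ A : Set Z, MeasurableSet A → Measurable fun p => W p A) ∧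
    ∀ p, IsProbabilityMeasure (W p)

/-- Essential supremum of the total mass of a positive measure-valued kernel. -/
def TVboundPos (W : Sq → Measure Z) : ℝ≥0∞ :=
  essSup (fun p => W p Set.univ) (volume : Measure Sq)

/-- A (positive) measure-valued kernel: measurable and essentially bounded. -/
def IsPosKernel (W : Sq → Measure Z) : Prop :=
  (∀ A : Set Z, MeasurableSet A → Measurable fun p => W p A) ∧ TVboundPos W < ⊤

/-- Relabeling `W^φ` of a kernel by a map `φ : [0,1] → [0,1]`. -/
def relabel (W : Sq → Measure Z) (φ : unitInterval → unitInterval) : Sq → Measure Z :=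
  fun p => W (φ p.1, φ p.2)

/-- `φ` is a Lebesgue-measure-preserving map of `[0,1]`. -/
def IsMP (φ : unitInterval → unitInterval) : Prop :=
  MeasurePreserving φ (volume : Measure unitInterval) (volume : Measure unitInterval)

/-- Weak convergence of a sequence of (finite) measures on `Z`. -/
def WeakTendsto (μ : ℕ → Measure Z) (ν : Measure Z) : Prop :=
  ∀ f : BoundedContinuousFunction Z ℝ,
    Tendsto (fun n => ∫ x, f x ∂(μ n)) atTop (𝓝 (∫ x, f x ∂ν))

/-- The cut distance `d_{□,m}` associated with a distance `d_m` on measures. -/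
def cutDist (dm : Measure Z → Measure Z → ℝ) (U W : Sq → Measure Z) : ℝ :=
  ⨆ ST : {p : Set unitInterval × Set unitInterval // MeasurableSet p.1 ∧ MeasurableSet p.2},
    dm (kernelInt U (ST.val.1 ×ˢ ST.val.2)) (kernelInt W (ST.val.1 ×ˢ ST.val.2))

/-- The unlabeled cut distance `δ_□` associated with a distance `d` on kernels:
`δ_□(U,W) = inf_{φ ∈ S_{[0,1]}} d(U, W^φ)`. -/
def deltaCut (d : (Sq → Measure Z) → (Sq → Measure Z) → ℝ) (U W : Sq → Measure Z) : ℝ :=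
  ⨅ φ : {φ : unitInterval → unitInterval // IsMP φ ∧ Function.Bijective φ},
    d U (relabel W φ.val)

/-- Weak isomorphism of kernels: `U^φ = W^ψ` a.e. for some measure-preserving `φ, ψ`. -/
def WeakIso (U W : Sq → Measure Z) : Prop :=
  ∃ φ ψ : unitInterval → unitInterval, IsMP φ ∧ IsMP ψ ∧
    relabel U φ =ᵐ[(volume : Measure Sq)] relabel W ψ

/-- A family of kernels is tight if the family of measures `{M_W}` is tight. -/
def TightFamily (K : Set (Sq → Measure Z)) : Prop :=
  ∀ ε : ℝ≥0∞, 0 < ε → ∃ K₀ : Set Z, IsCompact K₀ ∧ ∀ W ∈ K, MW W K₀ᶜ ≤ ε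

/-- Invariance of a distance on probability-graphons under bijective
measure-preserving relabelings. -/
def Invariant (d : (Sq → Measure Z) → (Sq → Measure Z) → ℝ) : Prop :=
  ∀ U W : Sq → Measure Z, IsProbGraphon U → IsProbGraphon W →
    ∀ φ : unitInterval → unitInterval, IsMP φ → Function.Bijective φ →
      d (relabel U φ) (relabel W φ) = d U W

/-- Smoothness of a distance on probability-graphons: a.e. weak convergence implies
convergence in `d`. -/
def Smooth (d : (Sq → Measure Z) → (Sq → Measure Z) → ℝ) : Prop :=
  ∀ (Wn : ℕ → Sq → Measure Z) (W : Sq → Measure Z),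
    (∀ n, IsProbGraphon (Wn n)) → IsProbGraphon W →
    (∀ᵐ p ∂(volume : Measure Sq), WeakTendsto (fun n => Wn n p) (W p)) →
    Tendsto (fun n => d (Wn n) W) atTop (𝓝 0)

/-- `d` is a distance on the space `𝒲₁` of probability-graphons (where kernels that
agree a.e. are identified). -/
def IsGraphonDist (d : (Sq → Measure Z) → (Sq → Measure Z) → ℝ) : Prop :=
  (∀ U W, IsProbGraphon U → IsProbGraphon W → d U W = d W U) ∧
  (∀ U W, IsProbGraphon U → IsProbGraphon W → 0 ≤ d U W) ∧
  (∀ U V W, IsProbGraphon U → IsProbGraphon V → IsProbGraphon W → d U W ≤ d U V + d V W) ∧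
  (∀ U W, IsProbGraphon U → IsProbGraphon W →
    (d U W = 0 ↔ U =ᵐ[(volume : Measure Sq)] W))

/-- Distance axioms for `d` on a subset `M`. -/
def IsDistOnSet {α : Type*} (M : Set α) (d : α → α → ℝ) : Prop :=
  (∀ x ∈ M, ∀ y ∈ M, d x y = d y x) ∧
  (∀ x ∈ M, ∀ y ∈ M, 0 ≤ d x y) ∧
  (∀ x ∈ M, ∀ y ∈ M, ∀ z ∈ M, d x z ≤ d x y + d y z) ∧
  (∀ x ∈ M, ∀ y ∈ M, (d x y = 0 ↔ x = y))

/-- The set `ℳ≤1(Z)` of measures of total mass at most one. -/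
def SubProb (Z : Type*) [MeasurableSpace Z] : Set (Measure Z) := {μ | μ Set.univ ≤ 1}

/-- `d_m` is a distance on `ℳ≤1(Z)`. -/
def IsDistOnSubProb (dm : Measure Z → Measure Z → ℝ) : Prop :=
  IsDistOnSet (SubProb Z) dm

/-- `d_m` induces the weak topology on `ℳ≤1(Z)` (sequential formulation; the weak
topology on `ℳ≤1(Z)` is metrizable, so it is characterized by its convergent
sequences). -/
def InducesWeakTopologySub (dm : Measure Z → Measure Z → ℝ) : Prop :=
  ∀ (μn : ℕ → Measure Z) (μ : Measure Z), (∀ n, μn n ∈ SubProb Z) → μ ∈ SubProb Z →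
    (Tendsto (fun n => dm (μn n) μ) atTop (𝓝 0) ↔ WeakTendsto μn μ)

/-- Quasi-convexity of a distance on the convex set `ℳ₊(Z)` of finite measures. -/
def QuasiConvexPos (dm : Measure Z → Measure Z → ℝ) : Prop :=
  ∀ μ₁ μ₂ ν₁ ν₂ : Measure Z, IsFiniteMeasure μ₁ → IsFiniteMeasure μ₂ →
    IsFiniteMeasure ν₁ → IsFiniteMeasure ν₂ → ∀ a : ℝ≥0∞, a ≤ 1 →
    dm (a • μ₁ + (1 - a) • μ₂) (a • ν₁ + (1 - a) • ν₂) ≤ max (dm μ₁ ν₁) (dm μ₂ ν₂)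

/-! ### Finite partitions of `[0,1]` and the stepping operator -/

/-- A finite measurable partition of `[0,1]` (possibly with empty classes). -/
structure FinPartition : Type where
  n : ℕ
  part : Fin n → Set unitInterval
  measurableSet : ∀ i, MeasurableSet (part i)
  disjoint : ∀ i j, i ≠ j → Disjoint (part i) (part j)
  covers : (⋃ i, part i) = Set.univ

/-- `P` refines `Q`: every class of `P` is included in a class of `Q`. -/
def FinPartition.Refines (P Q : FinPartition) : Prop :=
  ∀ i, ∃ j, P.part i ⊆ Q.part j

/-- The stepping `W_𝒫` of a (positive) measure-valued kernel `W` with respect to a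
finite partition `𝒫`: on `S_i × S_j` it equals `W(S_i×S_j;·)/(λ(S_i)λ(S_j))`
(and the zero measure on classes of zero measure). -/
def stepping (W : Sq → Measure Z) (P : FinPartition) : Sq → Measure Z :=
  fun p => ∑ i : Fin P.n, ∑ j : Fin P.n,
    Set.indicator (P.part i ×ˢ P.part j)
      (fun _ => ((volume (P.part i)) * (volume (P.part j)))⁻¹ •
        kernelInt W (P.part i ×ˢ P.part j)) p

/-- Weak regularity of a distance on probability-graphons. -/
def WeaklyRegular (d : (Sq → Measure Z) → (Sq → Measure Z) → ℝ) : Prop :=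
  ∀ K : Set (Sq → Measure Z), (∀ W ∈ K, IsProbGraphon W) → TightFamily K →
    ∀ ε : ℝ, 0 < ε → ∃ m : ℕ, 0 < m ∧
      ∀ W ∈ K, ∀ Q : FinPartition, ∃ P : FinPartition,
        P.Refines Q ∧ P.n ≤ m * Q.n ∧ d W (stepping W P) < ε

/-- Regularity of a distance on probability-graphons with respect to the stepping
operator. -/
def SteppingRegular (d : (Sq → Measure Z) → (Sq → Measure Z) → ℝ) : Prop :=
  ∃ C₀ : ℝ, 0 < C₀ ∧ ∀ W U : Sq → Measure Z, IsProbGraphon W → IsProbGraphon U →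
    ∀ P : FinPartition, d W (stepping W P) ≤ C₀ * d W (stepping U P)

/-! ### Signed measure-valued kernels -/

/-- The signed measure associated with a finite measure (and junk value `0` on
non-finite measures). -/
def toSigned (μ : Measure Z) : SignedMeasure Z :=
  letI := Classical.dec (IsFiniteMeasure μ)
  if h : IsFiniteMeasure μ then @Measure.toSignedMeasure Z _ μ h else 0

/-- `W(A;·)` for a signed measure-valued kernel. -/
def skernelInt (W : Sq → SignedMeasure Z) (A : Set Sq) : SignedMeasure Z :=
  toSigned (((volume : Measure Sq).restrict A).bind
      fun p => (W p).toJordanDecomposition.posPart)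
    - toSigned (((volume : Measure Sq).restrict A).bind
      fun p => (W p).toJordanDecomposition.negPart)

/-- Total mass `‖s‖_TV` of the total variation of a signed measure. -/
def TVnorm (s : SignedMeasure Z) : ℝ≥0∞ := s.totalVariation Set.univ

/-- `‖W‖∞`, the essential supremum of the total variation masses of a signed
measure-valued kernel. -/
def TVbound (W : Sq → SignedMeasure Z) : ℝ≥0∞ :=
  essSup (fun p => TVnorm (W p)) (volume : Measure Sq)

/-- A signed measure-valued kernel: measurable in `(x,y)` and essentially bounded in
total variation. -/
def IsSignedKernel (W : Sq → SignedMeasure Z) : Prop :=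
  (∀ A : Set Z, MeasurableSet A → Measurable fun p => W p A) ∧ TVbound W < ⊤

/-- The measure `M_W = ∫ |W|(x,y;·) dx dy` of a signed measure-valued kernel. -/
def MWs (W : Sq → SignedMeasure Z) : Measure Z :=
  (volume : Measure Sq).bind fun p => (W p).totalVariation

/-- Tightness for a family of signed measure-valued kernels. -/
def TightFamilyS (K : Set (Sq → SignedMeasure Z)) : Prop :=
  ∀ ε : ℝ≥0∞, 0 < ε → ∃ K₀ : Set Z, IsCompact K₀ ∧ ∀ W ∈ K, MWs W K₀ᶜ ≤ ε

/-- Integral of a bounded continuous function against a signed measure. -/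
def sint (f : BoundedContinuousFunction Z ℝ) (s : SignedMeasure Z) : ℝ :=
  ∫ x, f x ∂s.toJordanDecomposition.posPart - ∫ x, f x ∂s.toJordanDecomposition.negPart

/-- Weak convergence of signed measures. -/
def WeakTendstoS (s : ℕ → SignedMeasure Z) (t : SignedMeasure Z) : Prop :=
  ∀ f : BoundedContinuousFunction Z ℝ,
    Tendsto (fun n => sint f (s n)) atTop (𝓝 (sint f t))

/-- Stepping of a signed measure-valued kernel with respect to a finite partition. -/
def steppingS (W : Sq → SignedMeasure Z) (P : FinPartition) : Sq → SignedMeasure Z :=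
  fun p => ∑ i : Fin P.n, ∑ j : Fin P.n,
    Set.indicator (P.part i ×ˢ P.part j)
      (fun _ => (((volume (P.part i)).toReal * (volume (P.part j)).toReal)⁻¹ : ℝ) •
        skernelInt W (P.part i ×ˢ P.part j)) p

/-- Cut distance for signed measure-valued kernels associated with a distance `d_m`
on signed measures. -/
def cutDistS (dm : SignedMeasure Z → SignedMeasure Z → ℝ) (U W : Sq → SignedMeasure Z) : ℝ :=
  ⨆ ST : {p : Set unitInterval × Set unitInterval // MeasurableSet p.1 ∧ MeasurableSet p.2},
    dm (skernelInt U (ST.val.1 ×ˢ ST.val.2)) (skernelInt W (ST.val.1 ×ˢ ST.val.2))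

/-- Quasi-convexity of a distance on a convex subset `M` of signed measures. -/
def QuasiConvexOn (M : Set (SignedMeasure Z)) (dm : SignedMeasure Z → SignedMeasure Z → ℝ) :
    Prop :=
  ∀ x₁ ∈ M, ∀ x₂ ∈ M, ∀ y₁ ∈ M, ∀ y₂ ∈ M, ∀ a : ℝ, 0 ≤ a → a ≤ 1 →
    dm (a • x₁ + (1 - a) • x₂) (a • y₁ + (1 - a) • y₂) ≤ max (dm x₁ y₁) (dm x₂ y₂)

/-! ### Convergence determining sequences and the associated norms -/

/-- `F` is a convergence determining sequence: `[0,1]`-valued bounded continuous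
functions, `F 0 = 1`, such that convergence of all moments `μ(f_k)` implies weak
convergence (for finite positive measures). -/
def IsConvDet (F : ℕ → BoundedContinuousFunction Z ℝ) : Prop :=
  F 0 = 1 ∧ (∀ k x, F k x ∈ Set.Icc (0:ℝ) 1) ∧
  ∀ (μn : ℕ → Measure Z) (μ : Measure Z), (∀ n, IsFiniteMeasure (μn n)) → IsFiniteMeasure μ →
    (∀ k, Tendsto (fun n => ∫ x, F k x ∂(μn n)) atTop (𝓝 (∫ x, F k x ∂μ))) →
    WeakTendsto μn μ

/-- `‖μ − ν‖_F = Σ_k 2^{-k} |μ(f_k) − ν(f_k)|` for positive measures. -/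
def Fdist (F : ℕ → BoundedContinuousFunction Z ℝ) (μ ν : Measure Z) : ℝ :=
  ∑' k : ℕ, (1/2 : ℝ) ^ k * |∫ x, F k x ∂μ - ∫ x, F k x ∂ν|

/-- The cut distance `d_{□,F}(U,W) = ‖U − W‖_{□,F}` on measure-valued kernels. -/
def cutDistF (F : ℕ → BoundedContinuousFunction Z ℝ) (U W : Sq → Measure Z) : ℝ :=
  ⨆ ST : {p : Set unitInterval × Set unitInterval // MeasurableSet p.1 ∧ MeasurableSet p.2},
    Fdist F (kernelInt U (ST.val.1 ×ˢ ST.val.2)) (kernelInt W (ST.val.1 ×ˢ ST.val.2))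

/-- The norm `‖s‖_F` of a signed measure. -/
def FnormS (F : ℕ → BoundedContinuousFunction Z ℝ) (s : SignedMeasure Z) : ℝ :=
  ∑' k : ℕ, (1/2 : ℝ) ^ k * |sint (F k) s|

/-- The cut norm `‖W‖_{□,F}` of a signed measure-valued kernel. -/
def cutNormFS (F : ℕ → BoundedContinuousFunction Z ℝ) (W : Sq → SignedMeasure Z) : ℝ :=
  ⨆ ST : {p : Set unitInterval × Set unitInterval // MeasurableSet p.1 ∧ MeasurableSet p.2},
    FnormS F (skernelInt W (ST.val.1 ×ˢ ST.val.2))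

/-- The norm `‖W‖_{2,F}` of a signed measure-valued kernel. -/
def norm2F (F : ℕ → BoundedContinuousFunction Z ℝ) (W : Sq → SignedMeasure Z) : ℝ :=
  Real.sqrt (∑' k : ℕ, (1/2 : ℝ) ^ k * ∫ p, (sint (F k) (W p)) ^ 2 ∂(volume : Measure Sq))

/-! ### Homomorphism densities and sampling -/

/-- The homomorphism density `t(F^g, W)` of a `C_b(Z)`-decorated finite directed graph
with vertex set `Fin v` and edge set `E` in a measure-valued kernel `W`. -/
def homDensity {v : ℕ} (E : Finset (Fin v × Fin v))
    (g : Fin v × Fin v → BoundedContinuousFunction Z ℝ) (W : Sq → Measure Z) : ℝ :=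
  ∫ x : Fin v → unitInterval,
    (∏ e ∈ E, ∫ z, g e z ∂(W (x e.1, x e.2))) ∂(volume : Measure (Fin v → unitInterval))

/-- The edge set of the complete directed graph on `k` vertices. -/
def completeEdges (k : ℕ) : Finset (Fin k × Fin k) :=
  Finset.univ.filter fun e => e.1 ≠ e.2

/-- The `i`-th step `((i)/k, (i+1)/k]` of the uniform partition of `[0,1]` into `k`
intervals. -/
def stepSet (k : ℕ) (i : Fin k) : Set unitInterval :=
  {t | (i : ℝ) / k < (t : ℝ) ∧ (t : ℝ) ≤ ((i : ℝ) + 1) / k}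

/-- The stepfunction `W_x` sampled from `W` at the points `x = (x₁, …, x_k)`. -/
def sample (W : Sq → Measure Z) {k : ℕ} (x : Fin k → unitInterval) : Sq → Measure Z :=
  fun p => ∑ i : Fin k, ∑ j : Fin k,
    Set.indicator (stepSet k i ×ˢ stepSet k j) (fun _ => W (x i, x j)) p

/-- The probability-graphon associated with the `Z`-weighted complete graph on `k`
vertices with weights `β`. -/
def graphonOfWeights {k : ℕ} (β : Fin k × Fin k → Z) : Sq → Measure Z :=
  fun p => ∑ i : Fin k, ∑ j : Fin k,
    Set.indicator (stepSet k i ×ˢ stepSet k j) (fun _ => Measure.dirac (β (i, j))) p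

/-- The joint law of `(X, (β_{ij}))` where `X` is uniform on `[0,1]^k` and, given `X`,
the weights `β_{ij}` are independent with respective laws `W(X_i, X_j;·)`. -/
def sampleLaw (W : Sq → Measure Z) (k : ℕ) :
    Measure ((Fin k → unitInterval) × (Fin k × Fin k → Z)) :=
  (volume : Measure (Fin k → unitInterval)).bind fun x =>
    (Measure.pi fun e : Fin k × Fin k => W (x e.1, x e.2)).map (Prod.mk x)

/-! ### Rademacher signs -/

section Signs

variable {ι : Type*} [DecidableEq ι]

/-- The sign `±1` encoded by a Boolean. -/
def sgn (b : Bool) : ℝ := if b then 1 else -1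

lemma sgn_not (b : Bool) : sgn (!b) = -sgn b := by cases b <;> simp [sgn]

lemma sgn_mul_self (b : Bool) : sgn b * sgn b = 1 := by cases b <;> simp [sgn]

/-- Flip the `i`-th Boolean. -/
def flipAt (i : ι) (σ : ι → Bool) : ι → Bool := Function.update σ i (!σ i)

lemma flipAt_same (i : ι) (σ : ι → Bool) : flipAt i σ i = !σ i := by simp [flipAt]

lemma flipAt_of_ne {i j : ι} (h : j ≠ i) (σ : ι → Bool) : flipAt i σ j = σ j := by
  simp [flipAt, h]

lemma flipAt_involutive (i : ι) : Function.Involutive (flipAt (ι := ι) i) := by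
  intro σ
  funext j
  by_cases h : j = i
  · subst h; simp [flipAt]
  · simp [flipAt, h]

variable [Fintype ι]

lemma sum_flipAt (i : ι) (f : (ι → Bool) → ℝ) : ∑ σ, f (flipAt i σ) = ∑ σ, f σ :=
  Equiv.sum_comp (flipAt_involutive i).toPerm f

lemma sum_not (f : (ι → Bool) → ℝ) : ∑ σ : ι → Bool, f (fun i => !σ i) = ∑ σ, f σ := by
  have h : Function.Involutive (fun (σ : ι → Bool) i => !σ i) := by
    intro σ; funext i; simp
  exact Equiv.sum_comp h.toPerm f

lemma sum_eq_zero_of_flipAt (i : ι) (f : (ι → Bool) → ℝ) (h : ∀ σ, f (flipAt i σ) = -f σ) :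
    ∑ σ, f σ = 0 := by
  have h1 := sum_flipAt i f
  simp only [h, Finset.sum_neg_distrib] at h1
  linarith

lemma sum_sgn (i : ι) : ∑ σ : ι → Bool, sgn (σ i) = 0 :=
  sum_eq_zero_of_flipAt i _ fun σ => by rw [flipAt_same, sgn_not]

lemma sum_sgn_mul_sgn {i j : ι} (h : j ≠ i) : ∑ σ : ι → Bool, sgn (σ i) * sgn (σ j) = 0 :=
  sum_eq_zero_of_flipAt i _ fun σ => by rw [flipAt_same, flipAt_of_ne h, sgn_not, neg_mul]

lemma card_bool_fun : ∑ _σ : ι → Bool, (1 : ℝ) = 2 ^ Fintype.card ι := by simp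

/-- Khinchine's inequality (the easy direction, for coefficients bounded by one). -/
lemma sum_abs_sgn_le (B : Finset ι) (a : ι → ℝ) (ha : ∀ i, |a i| ≤ 1) :
    ∑ σ : ι → Bool, |∑ i ∈ B, sgn (σ i) * a i| ≤ 2 ^ Fintype.card ι * √(B.card) := by
  have hsq : ∑ σ : ι → Bool, (∑ i ∈ B, sgn (σ i) * a i) ^ 2
      = 2 ^ Fintype.card ι * ∑ i ∈ B, a i ^ 2 := by
    have h1 : ∀ σ : ι → Bool, (∑ i ∈ B, sgn (σ i) * a i) ^ 2
        = ∑ i ∈ B, ∑ j ∈ B, (a i * a j) * (sgn (σ i) * sgn (σ j)) := by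
      intro σ
      rw [sq, Finset.sum_mul_sum]
      exact Finset.sum_congr rfl fun i _ => Finset.sum_congr rfl fun j _ => by ring
    simp_rw [h1]
    rw [Finset.sum_comm, Finset.mul_sum]
    refine Finset.sum_congr rfl fun i hi => ?_
    rw [Finset.sum_comm, Finset.sum_eq_single i]
    · simp_rw [sgn_mul_self]
      rw [← Finset.mul_sum, card_bool_fun]; ring
    · intro j _ hj
      rw [← Finset.mul_sum, sum_sgn_mul_sgn hj, mul_zero]
    · exact fun h => absurd hi h
  have hB : ∑ i ∈ B, a i ^ 2 ≤ B.card := by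
    calc ∑ i ∈ B, a i ^ 2 ≤ ∑ i ∈ B, (1 : ℝ) :=
          Finset.sum_le_sum fun i _ => by rw [sq_le_one_iff_abs_le_one]; exact ha i
      _ = B.card := by simp
  have hcs := sq_sum_le_card_mul_sum_sq (s := (Finset.univ : Finset (ι → Bool)))
    (f := fun σ => |∑ i ∈ B, sgn (σ i) * a i|)
  simp only [sq_abs, hsq] at hcs
  have hc : (((Finset.univ : Finset (ι → Bool)).card : ℕ) : ℝ) = 2 ^ Fintype.card ι := by simp
  rw [hc] at hcs
  refine abs_le_of_sq_le_sq' (a := _) ?_ (by positivity) |>.2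
  rw [mul_pow, Real.sq_sqrt (by positivity)]
  calc _ ≤ _ := hcs
    _ ≤ (2:ℝ) ^ Fintype.card ι * (2 ^ Fintype.card ι * B.card) := by gcongr
    _ = _ := by ring

/-- Decoupling: averaging over random bipartitions recovers a quarter of the
off-diagonal part of a double sum. -/
lemma sum_bipartition (a : ι → ι → ℝ) :
    4 * ∑ σ : ι → Bool, ∑ i, ∑ j, (if σ i = true ∧ σ j = false then a i j else 0)
      = 2 ^ Fintype.card ι * (∑ i, ∑ j, a i j - ∑ i, a i i) := by
  have h1 : ∀ (σ : ι → Bool) i j, (if σ i = true ∧ σ j = false then a i j else 0)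
      = a i j / 4 * ((1 + sgn (σ i)) * (1 - sgn (σ j))) := by
    intro σ i j
    cases σ i <;> cases σ j <;> simp [sgn]; ring
  simp_rw [h1]
  rw [Finset.sum_comm, ← Finset.sum_sub_distrib, Finset.mul_sum, Finset.mul_sum]
  refine Finset.sum_congr rfl fun i _ => ?_
  rw [Finset.sum_comm, mul_sub, Finset.mul_sum, Finset.mul_sum]
  have key : ∀ j, 4 * ∑ σ : ι → Bool, a i j / 4 * ((1 + sgn (σ i)) * (1 - sgn (σ j)))
      = 2 ^ Fintype.card ι * a i j - (if j = i then 2 ^ Fintype.card ι * a i i else 0) := by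
    intro j
    rw [← Finset.mul_sum]
    have : ∀ σ : ι → Bool, (1 + sgn (σ i)) * (1 - sgn (σ j))
        = 1 + sgn (σ i) - sgn (σ j) - sgn (σ i) * sgn (σ j) := fun σ => by ring
    simp_rw [this, Finset.sum_sub_distrib, Finset.sum_add_distrib, sum_sgn, card_bool_fun]
    split_ifs with h
    · subst h; simp_rw [sgn_mul_self, card_bool_fun]; ring
    · rw [sum_sgn_mul_sgn h]; ring
  rw [Finset.sum_congr rfl fun j _ => key j, Finset.sum_sub_distrib]
  simp

/-- One step of the contraction principle for positive parts, in terms of selections. -/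
lemma exists_contraction_step {V : Type*} (i : ι) (L : (ι → Bool) → V → ℝ)
    (hL : ∀ σ v, L (flipAt i σ) v = L σ v) (p : V → ℝ) (y : (ι → Bool) → V) :
    ∃ w : (ι → Bool) → V, (∀ σ, ∃ τ, w σ = y τ) ∧
      ∑ σ, (L σ (y σ) + sgn (σ i) * max (p (y σ)) 0)
        ≤ ∑ σ, (L σ (w σ) + sgn (σ i) * p (w σ)) := by
  classical
  let w : (ι → Bool) → V := fun σ =>
    if sgn (σ i) * p (y (flipAt i σ)) ≤ sgn (σ i) * p (y σ) then y σ else y (flipAt i σ)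
  refine ⟨w, fun σ => ?_, ?_⟩
  · by_cases h : sgn (σ i) * p (y (flipAt i σ)) ≤ sgn (σ i) * p (y σ)
    · exact ⟨σ, by simp [w, h]⟩
    · exact ⟨flipAt i σ, by simp [w, h]⟩
  · have h2 : ∀ f : (ι → Bool) → ℝ, ∑ σ, f σ = (∑ σ, (f σ + f (flipAt i σ))) / 2 := by
      intro f
      rw [Finset.sum_add_distrib, sum_flipAt]; ring
    rw [h2, h2 fun σ => L σ (w σ) + sgn (σ i) * p (w σ)]
    refine div_le_div_of_nonneg_right (Finset.sum_le_sum fun σ _ => ?_) (by norm_num)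
    simp only [hL, w, flipAt_same, flipAt_involutive i σ, sgn_not]
    rcases le_total (p (y σ)) (p (y (flipAt i σ))) with h | h <;>
    cases hb : σ i <;> simp only [sgn] <;> split_ifs <;>
    rcases max_cases (p (y σ)) 0 with ⟨e1, _⟩ | ⟨e1, _⟩ <;>
    rcases max_cases (p (y (flipAt i σ))) 0 with ⟨e2, _⟩ | ⟨e2, _⟩ <;>
    rw [e1, e2] <;> linarith

lemma exists_contraction_aux {V : Type*} (a : V → ι → ℝ) (B : Finset ι) :
    ∀ (L : (ι → Bool) → V → ℝ) (_ : ∀ i ∈ B, ∀ σ v, L (flipAt i σ) v = L σ v)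
      (y : (ι → Bool) → V),
    ∃ w : (ι → Bool) → V, (∀ σ, ∃ τ, w σ = y τ) ∧
      ∑ σ, (L σ (y σ) + ∑ i ∈ B, sgn (σ i) * max (a (y σ) i) 0)
        ≤ ∑ σ, (L σ (w σ) + ∑ i ∈ B, sgn (σ i) * a (w σ) i) := by
  induction B using Finset.induction_on with
  | empty => exact fun L _ y => ⟨y, fun σ => ⟨σ, rfl⟩, by simp⟩
  | insert i B hi ih =>
    intro L hL y
    obtain ⟨w₁, hw₁, h₁⟩ := exists_contraction_step i
      (fun σ v => L σ v + ∑ j ∈ B, sgn (σ j) * max (a v j) 0)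
      (fun σ v => by
        rw [hL i (Finset.mem_insert_self _ _)]
        congr 1
        refine Finset.sum_congr rfl fun j hj => ?_
        rw [flipAt_of_ne (by rintro rfl; exact hi hj)])
      (fun v => a v i) y
    obtain ⟨w₂, hw₂, h₂⟩ := ih (fun σ v => L σ v + sgn (σ i) * a v i)
      (fun j hj σ v => by
        rw [hL j (Finset.mem_insert_of_mem hj), flipAt_of_ne (by rintro rfl; exact hi hj)]) w₁
    refine ⟨w₂, fun σ => ?_, ?_⟩
    · obtain ⟨τ, hτ⟩ := hw₂ σ
      obtain ⟨τ', hτ'⟩ := hw₁ τ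
      exact ⟨τ', hτ.trans hτ'⟩
    · simp only [Finset.sum_insert hi]
      refine le_trans (le_of_eq ?_) (h₁.trans (le_trans (le_of_eq ?_) (h₂.trans (le_of_eq ?_)))) <;>
      exact Finset.sum_congr rfl fun σ _ => by ring

/-- The contraction principle for Rademacher averages of positive parts, in terms of
selections. -/
lemma exists_contraction {V : Type*} (a : V → ι → ℝ) (B : Finset ι) (y : (ι → Bool) → V) :
    ∃ w : (ι → Bool) → V, (∀ σ, ∃ τ, w σ = y τ) ∧
      ∑ σ, ∑ i ∈ B, sgn (σ i) * max (a (y σ) i) 0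
        ≤ ∑ σ, ∑ i ∈ B, sgn (σ i) * a (w σ) i := by
  simpa using exists_contraction_aux a B (fun _ _ => 0) (by simp) y

end Signs

/-! ### Symmetrization -/

section Symmetrization

variable {Ω : Type*} [MeasurableSpace Ω] {ι : Type*} [Fintype ι] [DecidableEq ι]

lemma integral_comp_measurePreserving {α β : Type*} [MeasurableSpace α] [MeasurableSpace β]
    {μ : Measure α} {ν : Measure β} {f : α → β} (hf : MeasurePreserving f μ ν) {g : β → ℝ}
    (hg : Measurable g) : ∫ x, g (f x) ∂μ = ∫ y, g y ∂ν := by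
  rw [← hf.map_eq, integral_map hf.aemeasurable hg.aestronglyMeasurable]

lemma integrable_of_abs_le {α : Type*} [MeasurableSpace α] {μ : Measure α} [IsFiniteMeasure μ]
    {f : α → ℝ} (hf : Measurable f) {C : ℝ} (hC : ∀ x, |f x| ≤ C) : Integrable f μ :=
  Integrable.of_bound hf.aestronglyMeasurable C (Eventually.of_forall hC)

/-- Symmetrization followed by contraction: for a data-dependent function `g x` whose
Rademacher averages are bounded by `R` (uniformly over resamplings of the coordinates in `B`),
the empirical mean of the positive part of `g x` exceeds its true mean by at most `2 * R`. -/
lemma symmetrization (μ : Measure Ω) [IsProbabilityMeasure μ] (B : Finset ι)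
    (g : (ι → Ω) → Ω → ℝ) (hg : Measurable (Function.uncurry g)) {C : ℝ}
    (hC : ∀ x z, |g x z| ≤ C) {R : ℝ}
    (hR : ∀ (x : ι → Ω) (y : (ι → Bool) → ι → Ω) (p : ι → Ω), (∀ σ, ∀ i ∉ B, y σ i = x i) →
      ∑ σ, ∑ i ∈ B, sgn (σ i) * g (y σ) (p i) ≤ 2 ^ Fintype.card ι * R) :
    ∫ x, ∑ i ∈ B, max (g x (x i)) 0 ∂(Measure.pi fun _ : ι => μ)
      ≤ B.card * (∫ x, ∫ z, max (g x z) 0 ∂μ ∂(Measure.pi fun _ : ι => μ)) + 2 * R := by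
  set P : Measure (ι → Ω) := Measure.pi fun _ : ι => μ with hP
  set ν : Measure (ι → Ω × Ω) := Measure.pi fun _ : ι => μ.prod μ with hν
  have hfst : MeasurePreserving (fun (z : ι → Ω × Ω) i => (z i).1) ν P :=
    measurePreserving_pi (fun _ => μ.prod μ) (fun _ => μ) fun _ => measurePreserving_fst
  have hg' : Measurable fun q : (ι → Ω) × Ω => max (g q.1 q.2) 0 := hg.max measurable_const
  have hC' : ∀ x z, |max (g x z) 0| ≤ C := fun x z =>
    abs_le.2 ⟨by have := (abs_nonneg _).trans (hC x z); have := le_max_right (g x z) 0; linarith,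
      max_le ((le_abs_self _).trans (hC x z)) ((abs_nonneg _).trans (hC x z))⟩
  have hpair : ∀ i, MeasurePreserving (fun z : ι → Ω × Ω => ((fun j => (z j).1), (z i).2)) ν
      (P.prod μ) := fun i =>
    ((MeasurePreserving.id P).prod (measurePreserving_eval (fun _ => μ) i)).comp
      (measurePreserving_arrowProdEquivProdArrow Ω Ω ι (fun _ => μ) (fun _ => μ))
  let Q : (ι → Ω × Ω) → ℝ := fun z =>
    ∑ i ∈ B, (max (g (fun j => (z j).1) (z i).1) 0 - max (g (fun j => (z j).1) (z i).2) 0)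
  have hm1 : ∀ i, Measurable fun z : ι → Ω × Ω => max (g (fun j => (z j).1) (z i).1) 0 :=
    fun i => hg'.comp (f := fun z : ι → Ω × Ω => ((fun j => (z j).1), (z i).1)) (by fun_prop)
  have hm2 : ∀ i, Measurable fun z : ι → Ω × Ω => max (g (fun j => (z j).1) (z i).2) 0 :=
    fun i => hg'.comp (f := fun z : ι → Ω × Ω => ((fun j => (z j).1), (z i).2)) (by fun_prop)
  have hQm : Measurable Q := Finset.measurable_sum _ fun i _ => (hm1 i).sub (hm2 i)
  have hi1 : ∀ i, Integrable (fun z : ι → Ω × Ω => max (g (fun j => (z j).1) (z i).1) 0) ν :=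
    fun i => integrable_of_abs_le (hm1 i) fun _ => hC' _ _
  have hi2 : ∀ i, Integrable (fun z : ι → Ω × Ω => max (g (fun j => (z j).1) (z i).2) 0) ν :=
    fun i => integrable_of_abs_le (hm2 i) fun _ => hC' _ _
  have hQi : Integrable Q ν := integrable_finsetSum _ fun i _ => (hi1 i).sub (hi2 i)
  -- the integral of `Q` is the quantity to estimate
  have hQint : ∫ z, Q z ∂ν = ∫ x, ∑ i ∈ B, max (g x (x i)) 0 ∂P
      - B.card * ∫ x, ∫ z, max (g x z) 0 ∂μ ∂P := by
    simp only [Q]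
    have hi12 : ∀ i ∈ B, Integrable (fun z : ι → Ω × Ω => max (g (fun j => (z j).1) (z i).1) 0
        - max (g (fun j => (z j).1) (z i).2) 0) ν := fun i _ => (hi1 i).sub (hi2 i)
    rw [integral_finsetSum _ hi12]
    have hx : ∀ i, Measurable fun x : ι → Ω => max (g x (x i)) 0 := fun i =>
      hg'.comp (f := fun x : ι → Ω => (x, x i)) (by fun_prop)
    rw [integral_finsetSum _ fun i _ => integrable_of_abs_le (hx i) fun _ => hC' _ _]
    have : ∀ i ∈ B, ∫ z : ι → Ω × Ω, (max (g (fun j => (z j).1) (z i).1) 0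
          - max (g (fun j => (z j).1) (z i).2) 0) ∂ν
        = ∫ x, max (g x (x i)) 0 ∂P - ∫ x, ∫ z, max (g x z) 0 ∂μ ∂P := by
      intro i _
      rw [integral_sub (hi1 i) (hi2 i), integral_comp_measurePreserving hfst (hx i),
        integral_comp_measurePreserving (hpair i) hg',
        integral_prod _ (integrable_of_abs_le hg' fun _ => hC' _ _)]
    rw [Finset.sum_congr rfl this, Finset.sum_sub_distrib]
    simp
  -- swapping coordinates preserves the measure
  let S : (ι → Bool) → (ι → Ω × Ω) → ι → Ω × Ω := fun σ z i =>
    if i ∈ B ∧ σ i = false then (z i).swap else z i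
  have hS : ∀ σ, MeasurePreserving (S σ) ν ν := fun σ =>
    measurePreserving_pi (fun _ => μ.prod μ) (fun _ => μ.prod μ)
      (f := fun i q => if i ∈ B ∧ σ i = false then q.swap else q) fun i => by
        by_cases h : i ∈ B ∧ σ i = false
        · simpa [h] using Measure.measurePreserving_swap
        · simpa [h] using! MeasurePreserving.id (μ.prod μ)
  have hpt : ∀ z, ∑ σ, Q (S σ z) ≤ 2 ^ Fintype.card ι * (2 * R) := by
    intro z
    let Y : (ι → Bool) → ι → Ω := fun σ j => (S σ z j).1
    have hY : ∀ σ, ∀ i ∉ B, Y σ i = (z i).1 := fun σ i hi => by simp [Y, S, hi]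
    have hQS : ∀ σ, Q (S σ z) = ∑ i ∈ B, sgn (σ i) * max (g (Y σ) (z i).1) 0
        + ∑ i ∈ B, sgn (!σ i) * max (g (Y σ) (z i).2) 0 := by
      intro σ
      rw [← Finset.sum_add_distrib]
      refine Finset.sum_congr rfl fun i hi => ?_
      change max (g (Y σ) (S σ z i).1) 0 - max (g (Y σ) (S σ z i).2) 0 = _
      cases h : σ i
      · have : S σ z i = (z i).swap := by simp [S, hi, h]
        rw [this]; simp [sgn]; ring
      · have : S σ z i = z i := by simp [S, h]
        rw [this]; simp [sgn]; ring
    simp_rw [hQS]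
    rw [Finset.sum_add_distrib]
    have hbd : ∀ (p : ι → Ω) (y : (ι → Bool) → ι → Ω), (∀ σ, ∀ i ∉ B, y σ i = (z i).1) →
        ∑ σ, ∑ i ∈ B, sgn (σ i) * max (g (y σ) (p i)) 0 ≤ 2 ^ Fintype.card ι * R := by
      intro p y hy
      obtain ⟨w, hw, hle⟩ := exists_contraction (fun x i => g x (p i)) B y
      refine hle.trans (hR (fun i => (z i).1) w p fun σ i hi => ?_)
      obtain ⟨τ, hτ⟩ := hw σ
      rw [hτ, hy τ i hi]
    have h1 := hbd (fun i => (z i).1) Y hY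
    have h2 := hbd (fun i => (z i).2) (fun σ => Y fun i => !σ i) fun σ => hY _
    have h3 : ∑ σ : ι → Bool, ∑ i ∈ B, sgn (!σ i) * max (g (Y σ) (z i).2) 0
        = ∑ σ : ι → Bool, ∑ i ∈ B, sgn (σ i) * max (g (Y fun i => !σ i) (z i).2) 0 := by
      rw [← sum_not]
      simp
    rw [h3]
    linarith
  have hSi : ∀ σ ∈ (Finset.univ : Finset (ι → Bool)), Integrable (fun z => Q (S σ z)) ν :=
    fun σ _ => (hS σ).integrable_comp_of_integrable hQi
  have hsum : 2 ^ Fintype.card ι * ∫ z, Q z ∂ν = ∫ z, ∑ σ, Q (S σ z) ∂ν := by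
    rw [integral_finsetSum _ hSi]
    rw [Finset.sum_congr rfl fun σ _ => integral_comp_measurePreserving (hS σ) hQm]
    simp
  have hle : ∫ z, ∑ σ, Q (S σ z) ∂ν ≤ 2 ^ Fintype.card ι * (2 * R) := by
    refine (integral_mono (integrable_finsetSum _ hSi) (integrable_const _) hpt).trans ?_
    simp
  have := le_of_mul_le_mul_left (hsum.trans_le hle) (by positivity)
  rw [hQint] at this
  linarith

end Symmetrization

/-! ### Weighted families of real kernels -/

section KernelFamily

variable {Ω ι : Type*}

/-- The signed combination `∑ₙ wₙ εₙ hₙ` of a family of kernels. -/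
def combine (N : ℕ) (w : ℕ → ℝ) (h : ℕ → Ω × Ω → ℝ) (ε : ℕ → ℝ) (p : Ω × Ω) : ℝ :=
  ∑ n ∈ Finset.range N, w n * (ε n * h n p)

/-- The weighted sum of absolute values of a family of reals. -/
def weightedAbs (N : ℕ) (w : ℕ → ℝ) (a : ℕ → ℝ) : ℝ :=
  ∑ n ∈ Finset.range N, w n * |a n|

lemma sum_mul_combine (N : ℕ) (w : ℕ → ℝ) (h : ℕ → Ω × Ω → ℝ) (ε : ℕ → ℝ) (B : Finset ι)
    (t : ι → ℝ) (p : ι → Ω × Ω) :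
    ∑ j ∈ B, t j * combine N w h ε (p j)
      = ∑ n ∈ Finset.range N, w n * (ε n * ∑ j ∈ B, t j * h n (p j)) := by
  simp only [combine, Finset.mul_sum]
  rw [Finset.sum_comm]
  exact Finset.sum_congr rfl fun n _ => Finset.sum_congr rfl fun j _ => by ring

variable [MeasurableSpace Ω]

/-- A finite weighted family of measurable kernels with values in `[-1,1]` and nonnegative
weights of total mass at most one. -/
structure IsKernelFamily (N : ℕ) (w : ℕ → ℝ) (h : ℕ → Ω × Ω → ℝ) : Prop where
  weight_nonneg : ∀ n, 0 ≤ w n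
  sum_weight_le : ∑ n ∈ Finset.range N, w n ≤ 1
  measurable : ∀ n, Measurable (h n)
  abs_le_one : ∀ n p, |h n p| ≤ 1

lemma IsKernelFamily.weightedAbs_le {N : ℕ} {w : ℕ → ℝ} {h : ℕ → Ω × Ω → ℝ}
    (H : IsKernelFamily N w h) {a : ℕ → ℝ} {C : ℝ} (hC : 0 ≤ C) (ha : ∀ n, |a n| ≤ C) :
    weightedAbs N w a ≤ C := by
  calc weightedAbs N w a ≤ ∑ n ∈ Finset.range N, w n * C :=
        Finset.sum_le_sum fun n _ => mul_le_mul_of_nonneg_left (ha n) (H.weight_nonneg n)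
    _ = (∑ n ∈ Finset.range N, w n) * C := by rw [Finset.sum_mul]
    _ ≤ 1 * C := mul_le_mul_of_nonneg_right H.sum_weight_le hC
    _ = C := one_mul C

lemma IsKernelFamily.sum_mul_le_weightedAbs {N : ℕ} {w : ℕ → ℝ} {h : ℕ → Ω × Ω → ℝ}
    (H : IsKernelFamily N w h) {ε a : ℕ → ℝ} (hε : ∀ n, |ε n| ≤ 1) :
    ∑ n ∈ Finset.range N, w n * (ε n * a n) ≤ weightedAbs N w a := by
  refine Finset.sum_le_sum fun n _ => mul_le_mul_of_nonneg_left ?_ (H.weight_nonneg n)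
  calc ε n * a n ≤ |ε n * a n| := le_abs_self _
    _ = |ε n| * |a n| := abs_mul _ _
    _ ≤ 1 * |a n| := mul_le_mul_of_nonneg_right (hε n) (abs_nonneg _)
    _ = |a n| := one_mul _

lemma weightedAbs_nonneg {N : ℕ} {w a : ℕ → ℝ} (hw : ∀ n, 0 ≤ w n) : 0 ≤ weightedAbs N w a :=
  Finset.sum_nonneg fun n _ => mul_nonneg (hw n) (abs_nonneg _)

lemma IsKernelFamily.abs_combine_le {N : ℕ} {w : ℕ → ℝ} {h : ℕ → Ω × Ω → ℝ}
    (H : IsKernelFamily N w h) {ε : ℕ → ℝ} (hε : ∀ n, |ε n| ≤ 1) (p : Ω × Ω) :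
    |combine N w h ε p| ≤ 1 := by
  have h1 := H.weightedAbs_le zero_le_one (a := fun n => h n p) fun n => H.abs_le_one n p
  refine abs_le.2 ⟨?_, (H.sum_mul_le_weightedAbs hε).trans h1⟩
  have h2 := H.sum_mul_le_weightedAbs (ε := fun n => -ε n) (a := fun n => h n p)
    (by simpa using hε)
  have h3 : ∑ n ∈ Finset.range N, w n * (-ε n * h n p) = -combine N w h ε p := by
    simp [combine]
  linarith

lemma IsKernelFamily.measurable_combine {N : ℕ} {w : ℕ → ℝ} {h : ℕ → Ω × Ω → ℝ}
    (H : IsKernelFamily N w h) {α : Type*} [MeasurableSpace α] {ε : α → ℕ → ℝ} {p : α → Ω × Ω}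
    (hε : Measurable ε) (hp : Measurable p) :
    Measurable fun a => combine N w h (ε a) (p a) :=
  Finset.measurable_sum _ fun n _ =>
    (((measurable_pi_apply n).comp hε).mul ((H.measurable n).comp hp)).const_mul _

lemma IsKernelFamily.sum_signs_weightedAbs_le [Fintype ι] [DecidableEq ι] {N : ℕ} {w : ℕ → ℝ}
    {h : ℕ → Ω × Ω → ℝ} (H : IsKernelFamily N w h) (B : Finset ι) (p : ι → Ω × Ω) :
    ∑ σ : ι → Bool, weightedAbs N w (fun n => ∑ j ∈ B, sgn (σ j) * h n (p j))
      ≤ 2 ^ Fintype.card ι * √(B.card) := by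
  simp only [weightedAbs]
  rw [Finset.sum_comm]
  simp_rw [← Finset.mul_sum]
  calc _ ≤ ∑ n ∈ Finset.range N, w n * (2 ^ Fintype.card ι * √(B.card)) :=
        Finset.sum_le_sum fun n _ => mul_le_mul_of_nonneg_left
          (sum_abs_sgn_le B _ fun i => H.abs_le_one n _) (H.weight_nonneg n)
    _ = (∑ n ∈ Finset.range N, w n) * (2 ^ Fintype.card ι * √(B.card)) := by rw [Finset.sum_mul]
    _ ≤ 1 * (2 ^ Fintype.card ι * √(B.card)) :=
        mul_le_mul_of_nonneg_right H.sum_weight_le (by positivity)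
    _ = _ := one_mul _

/-- The decoupled estimate: rows are sampled along `A`, columns along the complement of `A`. -/
lemma IsKernelFamily.integral_decoupled_le [Fintype ι] [DecidableEq ι] {N : ℕ} {w : ℕ → ℝ}
    {h : ℕ → Ω × Ω → ℝ} (H : IsKernelFamily N w h) (μ : Measure Ω) [IsProbabilityMeasure μ]
    {c : ℝ} (hc : ∀ S T : Set Ω, MeasurableSet S → MeasurableSet T →
      weightedAbs N w (fun n => ∫ p in S ×ˢ T, h n p ∂(μ.prod μ)) ≤ c)
    (A : Finset ι) {s : (ι → Ω) → ι → ℝ} (hs : Measurable s)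
    (hs01 : ∀ x i, s x i ∈ Set.Icc (0 : ℝ) 1) {ε : (ι → Ω) → ℕ → ℝ} (hε : Measurable ε)
    (hε1 : ∀ x n, |ε x n| ≤ 1) :
    ∫ x, ∑ j ∈ Aᶜ, max (∑ i ∈ A, s x i * combine N w h (ε x) (x i, x j)) 0
        ∂(Measure.pi fun _ : ι => μ)
      ≤ Aᶜ.card * (A.card * c + 2 * √(A.card)) + 2 * (A.card * √(Aᶜ.card)) := by
  set P : Measure (ι → Ω) := Measure.pi fun _ : ι => μ with hP
  let φ : (ι → Ω) → Ω → ℝ := fun x z => ∑ i ∈ A, s x i * combine N w h (ε x) (x i, z)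
  have hφm : Measurable (Function.uncurry φ) := by
    refine Finset.measurable_sum _ fun i _ => Measurable.mul ?_ ?_
    · exact (measurable_pi_apply i).comp (hs.comp measurable_fst)
    · exact H.measurable_combine (hε.comp measurable_fst) (by fun_prop)
  have hφb : ∀ x z, |φ x z| ≤ A.card := fun x z => by
    refine (Finset.abs_sum_le_sum_abs _ _).trans ?_
    calc _ ≤ ∑ i ∈ A, (1 : ℝ) := Finset.sum_le_sum fun i _ => by
          rw [abs_mul, abs_of_nonneg (hs01 x i).1]
          exact mul_le_one₀ (hs01 x i).2 (abs_nonneg _) (H.abs_combine_le (hε1 x) _)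
      _ = A.card := by simp
  have stepI := symmetrization μ Aᶜ φ hφm hφb (R := A.card * √(Aᶜ.card)) (by
    intro x y p hy
    have h1 : ∀ σ, ∑ j ∈ Aᶜ, sgn (σ j) * φ (y σ) (p j)
        ≤ ∑ i ∈ A, weightedAbs N w (fun n => ∑ j ∈ Aᶜ, sgn (σ j) * h n (x i, p j)) := by
      intro σ
      have : ∑ j ∈ Aᶜ, sgn (σ j) * φ (y σ) (p j)
          = ∑ i ∈ A, s (y σ) i *
            ∑ j ∈ Aᶜ, sgn (σ j) * combine N w h (ε (y σ)) (x i, p j) := by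
        simp only [φ, Finset.mul_sum]
        rw [Finset.sum_comm]
        refine Finset.sum_congr rfl fun i hi => Finset.sum_congr rfl fun j _ => ?_
        rw [hy σ i (by simpa using hi)]; ring
      rw [this]
      refine Finset.sum_le_sum fun i _ => ?_
      rw [sum_mul_combine N w h _ Aᶜ (fun j => sgn (σ j)) fun j => (x i, p j)]
      refine (mul_le_mul_of_nonneg_left (H.sum_mul_le_weightedAbs (hε1 _)) (hs01 _ i).1).trans ?_
      exact mul_le_of_le_one_left (weightedAbs_nonneg H.weight_nonneg) (hs01 _ i).2
    refine (Finset.sum_le_sum fun σ _ => h1 σ).trans ?_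
    rw [Finset.sum_comm]
    refine (Finset.sum_le_sum fun i _ =>
      H.sum_signs_weightedAbs_le Aᶜ fun j => (x i, p j)).trans (le_of_eq ?_)
    simp; ring)
  let ψ : (ι → Ω) → Ω → ℝ := fun x p =>
    ∫ z, {z | 0 < φ x z}.indicator (fun z => combine N w h (ε x) (p, z)) z ∂μ
  have hφset : ∀ x, MeasurableSet {z | 0 < φ x z} := fun x =>
    measurableSet_lt measurable_const (hφm.comp measurable_prodMk_left)
  have hcm : ∀ x p, Measurable fun z => combine N w h (ε x) (p, z) := fun x p =>
    H.measurable_combine measurable_const (by fun_prop)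
  have hind : ∀ x p z,
      |{z | 0 < φ x z}.indicator (fun z => combine N w h (ε x) (p, z)) z| ≤ 1 := by
    intro x p z
    by_cases hz : z ∈ {z | 0 < φ x z}
    · rw [Set.indicator_of_mem hz]; exact H.abs_combine_le (hε1 x) _
    · rw [Set.indicator_of_notMem hz]; simp
  have hindi : ∀ x p, Integrable
      ({z | 0 < φ x z}.indicator (fun z => combine N w h (ε x) (p, z))) μ := fun x p =>
    integrable_of_abs_le ((hcm x p).indicator (hφset x)) (hind x p)
  have hψm : Measurable (Function.uncurry ψ) := by
    have : Measurable fun q : ((ι → Ω) × Ω) × Ω =>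
        {z | 0 < φ q.1.1 z}.indicator (fun z => combine N w h (ε q.1.1) (q.1.2, z)) q.2 := by
      have h2 : MeasurableSet {q : ((ι → Ω) × Ω) × Ω | 0 < φ q.1.1 q.2} :=
        measurableSet_lt measurable_const
          (hφm.comp (f := fun q : ((ι → Ω) × Ω) × Ω => (q.1.1, q.2)) (by fun_prop))
      exact Measurable.ite h2 (H.measurable_combine
        (hε.comp (measurable_fst.comp measurable_fst)) (by fun_prop)) measurable_const
    exact (this.stronglyMeasurable.integral_prod_right (ν := μ)
      (f := fun (q : (ι → Ω) × Ω) z => {z | 0 < φ q.1 z}.indicator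
        (fun z => combine N w h (ε q.1) (q.2, z)) z)).measurable
  have hψb : ∀ x p, |ψ x p| ≤ 1 := fun x p => by
    have := norm_integral_le_of_norm_le_const (μ := μ) (C := 1)
      (f := fun z => {z | 0 < φ x z}.indicator (fun z => combine N w h (ε x) (p, z)) z)
      (Eventually.of_forall fun z => hind x p z)
    simpa using this
  have stepII := symmetrization μ A ψ hψm hψb (R := √(A.card)) (by
    intro x y p _
    have h1 : ∀ σ, ∑ i ∈ A, sgn (σ i) * ψ (y σ) (p i)
        ≤ ∫ z, weightedAbs N w (fun n => ∑ i ∈ A, sgn (σ i) * h n (p i, z)) ∂μ := by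
      intro σ
      simp only [ψ, ← integral_const_mul]
      rw [← integral_finsetSum _ fun i _ => (hindi (y σ) (p i)).const_mul _]
      refine integral_mono (integrable_finsetSum _ fun i _ => (hindi (y σ) (p i)).const_mul _)
        (integrable_finsetSum _ fun n _ => ?_) fun z => ?_
      · refine (Integrable.abs (integrable_finsetSum _ fun i _ => ?_)).const_mul _
        exact (integrable_of_abs_le (C := 1) ((H.measurable n).comp measurable_prodMk_left)
          fun z => H.abs_le_one _ _).const_mul _
      · change ∑ i ∈ A, sgn (σ i) * {z | 0 < φ (y σ) z}.indicator
          (fun z => combine N w h (ε (y σ)) (p i, z)) z ≤ _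
        by_cases hz : z ∈ {z | 0 < φ (y σ) z}
        · simp only [Set.indicator_of_mem hz]
          rw [sum_mul_combine N w h _ A (fun j => sgn (σ j)) fun j => (p j, z)]
          exact H.sum_mul_le_weightedAbs (hε1 _)
        · simp only [Set.indicator_of_notMem hz]
          simpa using weightedAbs_nonneg H.weight_nonneg
    refine (Finset.sum_le_sum fun σ _ => h1 σ).trans ?_
    have hintg : ∀ σ ∈ (Finset.univ : Finset (ι → Bool)), Integrable
        (fun z => weightedAbs N w (fun n => ∑ i ∈ A, sgn (σ i) * h n (p i, z))) μ := by
      intro σ _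
      refine integrable_finsetSum _ fun n _ => ?_
      refine (Integrable.abs (integrable_finsetSum _ fun i _ => ?_)).const_mul _
      exact (integrable_of_abs_le (C := 1) ((H.measurable n).comp measurable_prodMk_left)
        fun z => H.abs_le_one _ _).const_mul _
    rw [← integral_finsetSum _ hintg]
    refine (integral_mono (integrable_finsetSum _ hintg) (integrable_const _) fun z =>
      H.sum_signs_weightedAbs_le A fun j => (p j, z)).trans ?_
    simp)
  -- the true mean of the positive part of `φ`, as a sum over the rows
  have hφψ : ∀ x, ∫ z, max (φ x z) 0 ∂μ ≤ ∑ i ∈ A, max (ψ x (x i)) 0 := by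
    intro x
    have h1 : ∀ z, max (φ x z) 0 = ∑ i ∈ A, s x i *
        {z | 0 < φ x z}.indicator (fun z => combine N w h (ε x) (x i, z)) z := by
      intro z
      by_cases hz : z ∈ {z | 0 < φ x z}
      · simp only [Set.indicator_of_mem hz]
        exact max_eq_left (le_of_lt hz)
      · simp only [Set.indicator_of_notMem hz]
        simpa using hz
    simp_rw [h1]
    rw [integral_finsetSum _ fun i _ => (hindi x (x i)).const_mul _]
    refine Finset.sum_le_sum fun i _ => ?_
    rw [integral_const_mul]
    change s x i * ψ x (x i) ≤ _
    calc s x i * ψ x (x i) ≤ s x i * max (ψ x (x i)) 0 :=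
          mul_le_mul_of_nonneg_left (le_max_left _ _) (hs01 x i).1
      _ ≤ max (ψ x (x i)) 0 := mul_le_of_le_one_left (le_max_right _ _) (hs01 x i).2
  -- the true mean of the positive part of `ψ` is an integral over a rectangle
  have hψc : ∀ x, ∫ p, max (ψ x p) 0 ∂μ ≤ c := by
    intro x
    have hψset : MeasurableSet {p | 0 < ψ x p} :=
      measurableSet_lt measurable_const (hψm.comp measurable_prodMk_left)
    have h1 : ∀ p, max (ψ x p) 0 = {p | 0 < ψ x p}.indicator (ψ x) p := by
      intro p
      by_cases hp : p ∈ {p | 0 < ψ x p}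
      · rw [Set.indicator_of_mem hp]; exact max_eq_left (le_of_lt hp)
      · rw [Set.indicator_of_notMem hp]; simpa using hp
    have hcombi : IntegrableOn (combine N w h (ε x)) ({p | 0 < ψ x p} ×ˢ {z | 0 < φ x z})
        (μ.prod μ) := (integrable_of_abs_le (H.measurable_combine measurable_const measurable_id)
          (H.abs_combine_le (hε1 x))).integrableOn
    simp_rw [h1]
    rw [integral_indicator hψset]
    have hψeq : ∀ p, ψ x p = ∫ z in {z | 0 < φ x z}, combine N w h (ε x) (p, z) ∂μ :=
      fun p => integral_indicator (hφset x)
    rw [setIntegral_congr_fun hψset fun p _ => hψeq p,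
      ← setIntegral_prod (combine N w h (ε x)) hcombi]
    simp only [combine]
    rw [integral_finsetSum _ fun n _ => (((integrable_of_abs_le (H.measurable n)
      (H.abs_le_one n)).integrableOn.const_mul _).const_mul _)]
    simp only [integral_const_mul]
    exact (H.sum_mul_le_weightedAbs (hε1 x)).trans (hc _ _ hψset (hφset x))
  have hmean : ∫ x, ∫ z, max (φ x z) 0 ∂μ ∂P ≤ A.card * c + 2 * √(A.card) := by
    have hi : Integrable (fun x => ∫ p, max (ψ x p) 0 ∂μ) P :=
      (integrable_of_abs_le (μ := P.prod μ) (hψm.max measurable_const) (C := 1)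
        fun q => abs_le.2 ⟨by linarith [le_max_right (Function.uncurry ψ q) 0],
          max_le ((le_abs_self _).trans (hψb _ _)) zero_le_one⟩).integral_prod_left
    have hi' : Integrable (fun x => ∫ z, max (φ x z) 0 ∂μ) P :=
      (integrable_of_abs_le (μ := P.prod μ) (hφm.max measurable_const) (C := A.card)
        fun q => abs_le.2 ⟨by
          linarith [le_max_right (Function.uncurry φ q) 0, Nat.cast_nonneg (α := ℝ) A.card],
          max_le ((le_abs_self _).trans (hφb _ _)) (Nat.cast_nonneg _)⟩).integral_prod_left
    have hi'' : Integrable (fun x => ∑ i ∈ A, max (ψ x (x i)) 0) P := by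
      refine integrable_finsetSum _ fun i _ => integrable_of_abs_le (C := 1) ?_ fun x => ?_
      · exact (hψm.comp (f := fun x : ι → Ω => (x, x i)) (by fun_prop)).max measurable_const
      · exact abs_le.2 ⟨by linarith [le_max_right (ψ x (x i)) 0],
          max_le ((le_abs_self _).trans (hψb _ _)) zero_le_one⟩
    have h1 := integral_mono hi' hi'' hφψ
    have h2 : ∫ x, ∫ p, max (ψ x p) 0 ∂μ ∂P ≤ c := by
      refine (integral_mono hi (integrable_const c) hψc).trans ?_
      simp
    have h3 := mul_le_mul_of_nonneg_left h2 (Nat.cast_nonneg (α := ℝ) A.card)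
    linarith
  have h4 := mul_le_mul_of_nonneg_left hmean (Nat.cast_nonneg (α := ℝ) Aᶜ.card)
  exact stepI.trans (by linarith)

end KernelFamily

/-! ### The cut norm of a sampled family of kernels -/

section Sampled

lemma measurable_sel_apply {α C : Type*} [MeasurableSpace α] [Finite C] {m : C → α → ℝ}
    (hm : ∀ c, Measurable (m c)) {sel : α → C} (hsel : Measurable[_, ⊤] sel) :
    Measurable fun a => m (sel a) a := by
  let _ : MeasurableSpace C := ⊤
  have : Measurable (fun q : C × α => m q.1 q.2) := measurable_from_prod_countable_right hm
  exact this.comp (hsel.prodMk measurable_id)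

lemma exists_measurable_argmax {α C : Type*} [MeasurableSpace α] [Fintype C] [Nonempty C]
    (m : C → α → ℝ) (hm : ∀ c, Measurable (m c)) :
    ∃ sel : α → C, Measurable[_, ⊤] sel ∧ ∀ a c, m c a ≤ m (sel a) a := by
  let _ : MeasurableSpace C := ⊤
  suffices h : ∀ s : Finset C, s.Nonempty →
      ∃ sel : α → C, Measurable sel ∧ ∀ a, ∀ c ∈ s, m c a ≤ m (sel a) a by
    obtain ⟨sel, h1, h2⟩ := h Finset.univ Finset.univ_nonempty
    exact ⟨sel, h1, fun a c => h2 a c (Finset.mem_univ c)⟩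
  intro s hs
  induction hs using Finset.Nonempty.cons_induction with
  | singleton c => exact ⟨fun _ => c, measurable_const, fun a d hd => by
      rw [Finset.mem_singleton.1 hd]⟩
  | cons c s hc hs ih =>
    obtain ⟨sel, h1, h2⟩ := ih
    have hmsel : Measurable fun a => m (sel a) a := measurable_sel_apply hm h1
    classical
    refine ⟨fun a => if m (sel a) a ≤ m c a then c else sel a,
      Measurable.ite (measurableSet_le hmsel (hm c)) measurable_const h1, fun a d hd => ?_⟩
    dsimp only
    rcases Finset.mem_cons.1 hd with rfl | hd
    · split_ifs with h
      · exact le_rfl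
      · exact (not_le.1 h).le
    · split_ifs with h
      · exact (h2 a d hd).trans h
      · exact h2 a d hd

variable {Ω ι : Type*}

/-- The weighted sum of absolute values of the kernel sums over the rectangle `S × T` of
sampled points. -/
def sampledSum (N : ℕ) (w : ℕ → ℝ) (h : ℕ → Ω × Ω → ℝ) (x : ι → Ω)
    (ST : Finset ι × Finset ι) : ℝ :=
  weightedAbs N w fun n => ∑ i ∈ ST.1, ∑ j ∈ ST.2, h n (x i, x j)

/-- The (unnormalized) cut norm of the sampled family of kernels. -/
def sampledMax (N : ℕ) (w : ℕ → ℝ) (h : ℕ → Ω × Ω → ℝ) (x : ι → Ω) : ℝ :=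
  ⨆ ST : Finset ι × Finset ι, sampledSum N w h x ST

lemma sampledSum_le_sampledMax [Finite ι] (N : ℕ) (w : ℕ → ℝ) (h : ℕ → Ω × Ω → ℝ) (x : ι → Ω)
    (ST : Finset ι × Finset ι) : sampledSum N w h x ST ≤ sampledMax N w h x :=
  le_ciSup (f := sampledSum N w h x) (Set.finite_range _).bddAbove ST

variable [MeasurableSpace Ω] {N : ℕ} {w : ℕ → ℝ} {h : ℕ → Ω × Ω → ℝ}

lemma IsKernelFamily.measurable_sampledSum (H : IsKernelFamily N w h)
    (ST : Finset ι × Finset ι) : Measurable fun x : ι → Ω => sampledSum N w h x ST := by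
  simp only [sampledSum, weightedAbs]
  refine Finset.measurable_sum _ fun n _ => ?_
  have : Measurable fun x : ι → Ω => ∑ i ∈ ST.1, ∑ j ∈ ST.2, h n (x i, x j) :=
    Finset.measurable_sum _ fun i _ => Finset.measurable_sum _ fun j _ =>
      (H.measurable n).comp (f := fun x : ι → Ω => (x i, x j)) (by fun_prop)
  exact (continuous_abs.measurable.comp this).const_mul _

variable [Fintype ι]

lemma IsKernelFamily.measurable_sampledMax (H : IsKernelFamily N w h) :
    Measurable fun x : ι → Ω => sampledMax N w h x :=
  Measurable.iSup fun ST => H.measurable_sampledSum ST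

lemma IsKernelFamily.abs_sampledMax_le (H : IsKernelFamily N w h) (x : ι → Ω) :
    |sampledMax N w h x| ≤ (Fintype.card ι : ℝ) ^ 2 := by
  have h0 : 0 ≤ sampledMax N w h x :=
    (weightedAbs_nonneg H.weight_nonneg).trans (sampledSum_le_sampledMax N w h x (∅, ∅))
  rw [abs_of_nonneg h0]
  refine ciSup_le fun ST => H.weightedAbs_le (by positivity) fun n => ?_
  calc |∑ i ∈ ST.1, ∑ j ∈ ST.2, h n (x i, x j)|
      ≤ ∑ i ∈ ST.1, ∑ j ∈ ST.2, (1 : ℝ) :=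
        (Finset.abs_sum_le_sum_abs _ _).trans (Finset.sum_le_sum fun i _ =>
          (Finset.abs_sum_le_sum_abs _ _).trans (Finset.sum_le_sum fun j _ => H.abs_le_one _ _))
    _ = ST.1.card * ST.2.card := by simp
    _ ≤ (Fintype.card ι : ℝ) * Fintype.card ι := by
        gcongr <;> exact Finset.card_le_univ _
    _ = _ := by ring

lemma IsKernelFamily.integrable_sampledMax (H : IsKernelFamily N w h) {P : Measure (ι → Ω)}
    [IsFiniteMeasure P] : Integrable (fun x => sampledMax N w h x) P :=
  integrable_of_abs_le H.measurable_sampledMax H.abs_sampledMax_le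

/-- Resampling one point changes the sampled cut norm by little. -/
lemma IsKernelFamily.sampledMax_le_add [DecidableEq ι] (H : IsKernelFamily N w h)
    {x y : ι → Ω} (i : ι) (hxy : ∀ j, j ≠ i → x j = y j) :
    sampledMax N w h x ≤ sampledMax N w h y + 4 * Fintype.card ι := by
  refine ciSup_le fun ST => ?_
  have hdiff : ∀ n, |∑ a ∈ ST.1, ∑ b ∈ ST.2, h n (x a, x b)
      - ∑ a ∈ ST.1, ∑ b ∈ ST.2, h n (y a, y b)| ≤ 4 * Fintype.card ι := by
    intro n
    simp_rw [← Finset.sum_sub_distrib]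
    calc _ ≤ ∑ a ∈ ST.1, ∑ b ∈ ST.2, ((if a = i then 2 else 0) + (if b = i then (2:ℝ) else 0)) := by
          refine (Finset.abs_sum_le_sum_abs _ _).trans (Finset.sum_le_sum fun a _ =>
            (Finset.abs_sum_le_sum_abs _ _).trans (Finset.sum_le_sum fun b _ => ?_))
          have h1 := abs_le.1 (H.abs_le_one n (x a, x b))
          have h2 := abs_le.1 (H.abs_le_one n (y a, y b))
          by_cases ha : a = i
          · rw [if_pos ha]
            have : (0:ℝ) ≤ if b = i then 2 else 0 := by positivity
            exact abs_le.2 ⟨by linarith, by linarith⟩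
          · by_cases hb : b = i
            · rw [if_pos hb, if_neg ha]
              exact abs_le.2 ⟨by linarith, by linarith⟩
            · rw [hxy a ha, hxy b hb]; simp [ha, hb]
      _ ≤ ∑ a : ι, ∑ b : ι, ((if a = i then 2 else 0) + (if b = i then (2:ℝ) else 0)) := by
          refine (Finset.sum_le_sum fun a _ => Finset.sum_le_sum_of_subset_of_nonneg
            (Finset.subset_univ _) fun b _ _ => by positivity).trans
            (Finset.sum_le_sum_of_subset_of_nonneg (Finset.subset_univ _) fun a _ _ => ?_)
          exact Finset.sum_nonneg fun b _ => by positivity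
      _ = 4 * Fintype.card ι := by
          simp only [Finset.sum_add_distrib, Finset.sum_const, Finset.sum_ite_eq',
            Finset.mem_univ, if_true, Finset.card_univ, nsmul_eq_mul, ← Finset.mul_sum]
          ring
  have hterm : ∀ n, w n * |∑ a ∈ ST.1, ∑ b ∈ ST.2, h n (x a, x b)|
      ≤ w n * |∑ a ∈ ST.1, ∑ b ∈ ST.2, h n (y a, y b)|
        + w n * |∑ a ∈ ST.1, ∑ b ∈ ST.2, h n (x a, x b)
            - ∑ a ∈ ST.1, ∑ b ∈ ST.2, h n (y a, y b)| := by
    intro n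
    have h1 := abs_sub_abs_le_abs_sub (∑ a ∈ ST.1, ∑ b ∈ ST.2, h n (x a, x b))
      (∑ a ∈ ST.1, ∑ b ∈ ST.2, h n (y a, y b))
    have h2 := mul_le_mul_of_nonneg_left h1 (H.weight_nonneg n)
    linarith
  calc sampledSum N w h x ST
      ≤ ∑ n ∈ Finset.range N, (w n * |∑ a ∈ ST.1, ∑ b ∈ ST.2, h n (y a, y b)|
          + w n * |∑ a ∈ ST.1, ∑ b ∈ ST.2, h n (x a, x b)
            - ∑ a ∈ ST.1, ∑ b ∈ ST.2, h n (y a, y b)|) :=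
by
        simp only [sampledSum, weightedAbs]
        exact Finset.sum_le_sum fun n _ => hterm n
    _ = sampledSum N w h y ST + weightedAbs N w (fun n =>
          ∑ a ∈ ST.1, ∑ b ∈ ST.2, h n (x a, x b)
            - ∑ a ∈ ST.1, ∑ b ∈ ST.2, h n (y a, y b)) := Finset.sum_add_distrib
    _ ≤ _ := add_le_add (sampledSum_le_sampledMax N w h y ST)
        (H.weightedAbs_le (by positivity) hdiff)

/-- The expected sampled cut norm is at most the cut norm, up to lower-order terms. -/
lemma IsKernelFamily.integral_sampledMax_le [DecidableEq ι] (H : IsKernelFamily N w h)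
    (μ : Measure Ω) [IsProbabilityMeasure μ] {c : ℝ}
    (hc : ∀ S T : Set Ω, MeasurableSet S → MeasurableSet T →
      weightedAbs N w (fun n => ∫ p in S ×ˢ T, h n p ∂(μ.prod μ)) ≤ c) :
    ∫ x, sampledMax N w h x ∂(Measure.pi fun _ : ι => μ)
      ≤ (Fintype.card ι : ℝ) ^ 2 * c + 8 * (Fintype.card ι * √(Fintype.card ι))
        + Fintype.card ι := by
  set P : Measure (ι → Ω) := Measure.pi fun _ : ι => μ with hP
  set k : ℝ := (Fintype.card ι : ℝ) with hk
  have hc0 : 0 ≤ c := (weightedAbs_nonneg H.weight_nonneg).trans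
    (hc ∅ ∅ MeasurableSet.empty MeasurableSet.empty)
  obtain ⟨sel, hsel, hmax⟩ := exists_measurable_argmax
    (fun (ST : Finset ι × Finset ι) (x : ι → Ω) => sampledSum N w h x ST)
    fun ST => H.measurable_sampledSum ST
  let s : (ι → Ω) → ι → ℝ := fun x i => if i ∈ (sel x).1 then 1 else 0
  let t : (ι → Ω) → ι → ℝ := fun x i => if i ∈ (sel x).2 then 1 else 0
  let ε : (ι → Ω) → ℕ → ℝ := fun x n =>
    if 0 ≤ ∑ i ∈ (sel x).1, ∑ j ∈ (sel x).2, h n (x i, x j) then 1 else -1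
  have hsm : Measurable s := measurable_pi_lambda _ fun i => measurable_sel_apply
    (m := fun (c : Finset ι × Finset ι) (_ : ι → Ω) => if i ∈ c.1 then (1 : ℝ) else 0)
    (fun _ => measurable_const) hsel
  have hεm : Measurable ε := measurable_pi_lambda _ fun n => measurable_sel_apply
    (m := fun (c : Finset ι × Finset ι) (x : ι → Ω) =>
      if 0 ≤ ∑ i ∈ c.1, ∑ j ∈ c.2, h n (x i, x j) then (1 : ℝ) else -1)
    (fun c => Measurable.ite (measurableSet_le measurable_const
      (Finset.measurable_sum _ fun i _ => Finset.measurable_sum _ fun j _ =>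
        (H.measurable n).comp (f := fun x : ι → Ω => (x i, x j)) (by fun_prop)))
      measurable_const measurable_const) hsel
  have hs01 : ∀ x i, s x i ∈ Set.Icc (0:ℝ) 1 := fun x i => by
    simp only [s]; split_ifs <;> simp
  have ht01 : ∀ x i, t x i ∈ Set.Icc (0:ℝ) 1 := fun x i => by
    simp only [t]; split_ifs <;> simp
  have hε1 : ∀ x n, |ε x n| ≤ 1 := fun x n => by
    simp only [ε]; split_ifs <;> simp
  let A : (ι → Bool) → Finset ι := fun σ => Finset.univ.filter fun i => σ i = true
  let D : (ι → Bool) → (ι → Ω) → ℝ := fun σ x =>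
    ∑ j ∈ (A σ)ᶜ, max (∑ i ∈ A σ, s x i * combine N w h (ε x) (x i, x j)) 0
  have hpt : ∀ x, 2 ^ Fintype.card ι * sampledMax N w h x
      ≤ 2 ^ Fintype.card ι * k + 4 * ∑ σ, D σ x := by
    intro x
    let a : ι → ι → ℝ := fun i j => s x i * (t x j * combine N w h (ε x) (x i, x j))
    have h1 : sampledMax N w h x = ∑ i, ∑ j, a i j := by
      have h2 : sampledMax N w h x = sampledSum N w h x (sel x) :=
        le_antisymm (ciSup_le fun ST => hmax x ST) (sampledSum_le_sampledMax N w h x _)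
      rw [h2]
      have h3 : ∀ i, ∑ j, a i j
          = s x i * ∑ n ∈ Finset.range N, w n * (ε x n * ∑ j, t x j * h n (x i, x j)) := by
        intro i
        rw [← sum_mul_combine N w h (ε x) Finset.univ (t x) fun j => (x i, x j), Finset.mul_sum]
      simp only [h3, sampledSum, weightedAbs, Finset.mul_sum]
      rw [Finset.sum_comm]
      refine Finset.sum_congr rfl fun n _ => ?_
      have h4 : |∑ i ∈ (sel x).1, ∑ j ∈ (sel x).2, h n (x i, x j)|
          = ε x n * ∑ i ∈ (sel x).1, ∑ j ∈ (sel x).2, h n (x i, x j) := by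
        simp only [ε]
        split_ifs with h0
        · rw [abs_of_nonneg h0, one_mul]
        · rw [abs_of_neg (not_le.1 h0)]; ring
      have h5 : ∑ i ∈ (sel x).1, ∑ j ∈ (sel x).2, h n (x i, x j)
          = ∑ i, ∑ j, s x i * (t x j * h n (x i, x j)) := by
        simp [s, t, Finset.sum_ite_mem]
      rw [h4, h5, Finset.mul_sum, Finset.mul_sum]
      refine Finset.sum_congr rfl fun i _ => ?_
      rw [Finset.mul_sum, Finset.mul_sum]
      exact Finset.sum_congr rfl fun j _ => by ring
    have hdiag : ∑ i, a i i ≤ k := by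
      calc ∑ i, a i i ≤ ∑ _i : ι, (1:ℝ) := Finset.sum_le_sum fun i _ => by
            have e1 := (abs_le.1 (H.abs_combine_le (hε1 x) (x i, x i))).2
            have e2 : t x i * combine N w h (ε x) (x i, x i) ≤ 1 := by
              nlinarith [(ht01 x i).1, (ht01 x i).2]
            change s x i * _ ≤ 1
            nlinarith [(hs01 x i).1, (hs01 x i).2]
        _ = k := by simp [hk]
    have hD : ∀ σ : ι → Bool,
        ∑ i, ∑ j, (if σ i = true ∧ σ j = false then a i j else 0) ≤ D σ x := by
      intro σ
      have e1 : ∑ i, ∑ j, (if σ i = true ∧ σ j = false then a i j else 0)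
          = ∑ j ∈ (A σ)ᶜ, t x j * ∑ i ∈ A σ, s x i * combine N w h (ε x) (x i, x j) := by
        have e2 : (A σ)ᶜ = Finset.univ.filter fun j => σ j = false := by
          ext j; simp [A]
        rw [Finset.sum_comm, e2, Finset.sum_filter]
        refine Finset.sum_congr rfl fun j _ => ?_
        by_cases hj : σ j = false
        · simp only [hj, and_true, if_true, A, Finset.sum_filter, Finset.mul_sum]
          refine Finset.sum_congr rfl fun i _ => ?_
          split_ifs
          · simp only [a]; ring
          · simp
        · simp [hj]
      rw [e1]
      refine Finset.sum_le_sum fun j _ => ?_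
      calc _ ≤ t x j * max (∑ i ∈ A σ, s x i * combine N w h (ε x) (x i, x j)) 0 :=
            mul_le_mul_of_nonneg_left (le_max_left _ _) (ht01 x j).1
        _ ≤ _ := mul_le_of_le_one_left (le_max_right _ _) (ht01 x j).2
    have hb := sum_bipartition a
    have hsum := Finset.sum_le_sum fun σ (_ : σ ∈ Finset.univ) => hD σ
    have hpow : (0:ℝ) ≤ 2 ^ Fintype.card ι := by positivity
    rw [h1]
    nlinarith [mul_le_mul_of_nonneg_left hdiag hpow]
  have hDi : ∀ σ ∈ (Finset.univ : Finset (ι → Bool)), Integrable (D σ) P := by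
    intro σ _
    refine integrable_finsetSum _ fun j _ => integrable_of_abs_le (C := (A σ).card) ?_ fun x => ?_
    · refine (Finset.measurable_sum _ fun i _ => Measurable.mul ?_ ?_).max measurable_const
      · exact (measurable_pi_apply i).comp hsm
      · exact H.measurable_combine hεm (by fun_prop)
    · rw [abs_of_nonneg (le_max_right _ _)]
      refine max_le ?_ (Nat.cast_nonneg _)
      calc _ ≤ ∑ i ∈ A σ, (1:ℝ) := Finset.sum_le_sum fun i _ => by
            have e1 := (abs_le.1 (H.abs_combine_le (hε1 x) (x i, x j))).2
            nlinarith [(hs01 x i).1, (hs01 x i).2]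
        _ = (A σ).card := by simp
  have hintg : 2 ^ Fintype.card ι * ∫ x, sampledMax N w h x ∂P
      ≤ 2 ^ Fintype.card ι * k + 4 * ∑ σ, ∫ x, D σ x ∂P := by
    rw [← integral_const_mul, ← integral_finsetSum _ hDi, ← integral_const_mul]
    refine (integral_mono (H.integrable_sampledMax.const_mul _)
      ((integrable_const _).add ((integrable_finsetSum _ hDi).const_mul _)) hpt).trans (le_of_eq ?_)
    rw [integral_add' (integrable_const _) ((integrable_finsetSum _ hDi).const_mul _)]
    simp
  have hDle : ∀ σ, ∫ x, D σ x ∂P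
      ≤ c * ((A σ).card * ((A σ)ᶜ).card) + 2 * (k * √k) := by
    intro σ
    refine (H.integral_decoupled_le μ hc (A σ) hsm hs01 hεm hε1).trans ?_
    have e1 : ((A σ).card : ℝ) + ((A σ)ᶜ).card = k := by
      rw [hk]; exact_mod_cast Finset.card_add_card_compl (A σ)
    have e2 : √((A σ).card : ℝ) ≤ √k :=
      Real.sqrt_le_sqrt (by linarith [Nat.cast_nonneg (α := ℝ) ((A σ)ᶜ).card])
    have e3 : √(((A σ)ᶜ).card : ℝ) ≤ √k :=
      Real.sqrt_le_sqrt (by linarith [Nat.cast_nonneg (α := ℝ) (A σ).card])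
    have e4 := mul_le_mul_of_nonneg_left e2 (Nat.cast_nonneg (α := ℝ) ((A σ)ᶜ).card)
    have e5 := mul_le_mul_of_nonneg_left e3 (Nat.cast_nonneg (α := ℝ) (A σ).card)
    have e6 : k * √k = ((A σ).card + ((A σ)ᶜ).card) * √k := by rw [e1]
    linarith
  have hcount : 4 * ∑ σ, ((A σ).card * ((A σ)ᶜ).card : ℝ)
      = 2 ^ Fintype.card ι * (k ^ 2 - k) := by
    have e0 := sum_bipartition (ι := ι) fun _ _ => 1
    have e1 : ∀ σ : ι → Bool, ∑ i, ∑ j, (if σ i = true ∧ σ j = false then (1:ℝ) else 0)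
        = (A σ).card * ((A σ)ᶜ).card := by
      intro σ
      have e2 : (A σ)ᶜ = Finset.univ.filter fun j => σ j = false := by
        ext j; simp [A]
      rw [e2, Finset.card_filter, Finset.card_filter]
      push_cast
      rw [Finset.sum_mul_sum]
      refine Finset.sum_congr rfl fun i _ => Finset.sum_congr rfl fun j _ => ?_
      by_cases hi : σ i = true <;> by_cases hj : σ j = false <;> simp [hi, hj]
    simp_rw [e1] at e0
    rw [e0]
    simp [hk, sq]
  have hsumD := Finset.sum_le_sum fun σ (_ : σ ∈ (Finset.univ : Finset (ι → Bool))) => hDle σ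
  rw [Finset.sum_add_distrib, ← Finset.mul_sum] at hsumD
  have hconst : ∑ _σ : ι → Bool, 2 * (k * √k) = 2 ^ Fintype.card ι * (2 * (k * √k)) := by
    simp
  rw [hconst] at hsumD
  have hpow : (0:ℝ) < 2 ^ Fintype.card ι := by positivity
  refine le_of_mul_le_mul_left (hintg.trans ?_) hpow
  have hk0 : 0 ≤ k := Nat.cast_nonneg _
  have hck := mul_nonneg hpow.le (mul_nonneg hc0 hk0)
  have hcc : c * (4 * ∑ σ, ((A σ).card * ((A σ)ᶜ).card : ℝ))
      = c * (2 ^ Fintype.card ι * (k ^ 2 - k)) := by rw [hcount]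
  nlinarith

/-- The cut norm is at most the expected sampled cut norm, up to lower-order terms. -/
lemma IsKernelFamily.weightedAbs_le_integral_sampledMax [DecidableEq ι]
    (H : IsKernelFamily N w h) (μ : Measure Ω) [IsProbabilityMeasure μ] {S T : Set Ω}
    (hS : MeasurableSet S) (hT : MeasurableSet T) :
    (Fintype.card ι : ℝ) ^ 2 * weightedAbs N w (fun n => ∫ p in S ×ˢ T, h n p ∂(μ.prod μ))
      ≤ ∫ x, sampledMax N w h x ∂(Measure.pi fun _ : ι => μ) + 2 * Fintype.card ι := by
  classical
  set P : Measure (ι → Ω) := Measure.pi fun _ : ι => μ with hP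
  set k : ℝ := (Fintype.card ι : ℝ) with hk
  let r : ℕ → Ω × Ω → ℝ := fun n => (S ×ˢ T).indicator (h n)
  have hrm : ∀ n, Measurable (r n) := fun n => (H.measurable n).indicator (hS.prod hT)
  have hr1 : ∀ n p, |r n p| ≤ 1 := fun n p => by
    by_cases hp : p ∈ S ×ˢ T
    · simp only [r, Set.indicator_of_mem hp]; exact H.abs_le_one n p
    · simp only [r, Set.indicator_of_notMem hp]; simp
  have hI : ∀ n, ∫ p in S ×ˢ T, h n p ∂(μ.prod μ) = ∫ p, r n p ∂(μ.prod μ) := fun n =>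
    (integral_indicator (hS.prod hT)).symm
  have hI1 : ∀ n, |∫ p, r n p ∂(μ.prod μ)| ≤ 1 := fun n => by
    have := norm_integral_le_of_norm_le_const (μ := μ.prod μ) (C := 1) (f := r n)
      (Eventually.of_forall fun z => hr1 n z)
    simpa using this
  have hxm : ∀ n i j, Measurable fun x : ι → Ω => r n (x i, x j) := fun n i j =>
    (hrm n).comp (f := fun x : ι → Ω => (x i, x j)) (by fun_prop)
  have hxi : ∀ n i j, Integrable (fun x : ι → Ω => r n (x i, x j)) P := fun n i j =>
    integrable_of_abs_le (hxm n i j) fun x => hr1 n _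
  have hoff : ∀ n i j, i ≠ j → ∫ x, r n (x i, x j) ∂P = ∫ p, r n p ∂(μ.prod μ) := by
    intro n i j hij
    have hind := (ProbabilityTheory.iIndepFun_pi (μ := fun _ : ι => μ)
      (X := fun _ : ι => (id : Ω → Ω)) fun _ => aemeasurable_id).indepFun hij
    have hmap := (ProbabilityTheory.indepFun_iff_map_prod_eq_prod_map_map
      (measurable_pi_apply i).aemeasurable (measurable_pi_apply j).aemeasurable).1 hind
    have hi := (measurePreserving_eval (fun _ : ι => μ) i).map_eq
    have hj := (measurePreserving_eval (fun _ : ι => μ) j).map_eq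
    have hmp : MeasurePreserving (fun x : ι → Ω => (x i, x j)) P (μ.prod μ) := by
      refine ⟨by fun_prop, ?_⟩
      refine hmap.trans ?_
      change (Measure.map (Function.eval i) P).prod (Measure.map (Function.eval j) P) = _
      rw [hi, hj]
    exact integral_comp_measurePreserving hmp (hrm n)
  let G : ℕ → (ι → Ω) → ℝ := fun n x => ∑ i, ∑ j, r n (x i, x j)
  have hGi : ∀ n, Integrable (G n) P := fun n =>
    integrable_finsetSum _ fun i _ => integrable_finsetSum _ fun j _ => hxi n i j
  have hEG : ∀ n, k ^ 2 * |∫ p, r n p ∂(μ.prod μ)| ≤ |∫ x, G n x ∂P| + 2 * k := by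
    intro n
    have e1 : ∫ x, G n x ∂P = ∑ i, ∑ j, ∫ x, r n (x i, x j) ∂P := by
      simp only [G]
      rw [integral_finsetSum _ fun i _ => integrable_finsetSum _ fun j _ => hxi n i j]
      exact Finset.sum_congr rfl fun i _ => integral_finsetSum _ fun j _ => hxi n i j
    have e2 : ∫ x, G n x ∂P - k ^ 2 * ∫ p, r n p ∂(μ.prod μ)
        = ∑ i, (∫ x, r n (x i, x i) ∂P - ∫ p, r n p ∂(μ.prod μ)) := by
      have e3 : k ^ 2 * ∫ p, r n p ∂(μ.prod μ)
          = ∑ _i : ι, ∑ _j : ι, ∫ p, r n p ∂(μ.prod μ) := by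
        simp [hk]; ring
      rw [e1, e3, ← Finset.sum_sub_distrib]
      refine Finset.sum_congr rfl fun i _ => ?_
      rw [← Finset.sum_sub_distrib, Finset.sum_eq_single i]
      · intro j _ hj
        rw [hoff n i j hj.symm, sub_self]
      · simp
    have e4 : |∫ x, G n x ∂P - k ^ 2 * ∫ p, r n p ∂(μ.prod μ)| ≤ 2 * k := by
      rw [e2]
      calc _ ≤ ∑ _i : ι, (2:ℝ) := (Finset.abs_sum_le_sum_abs _ _).trans
            (Finset.sum_le_sum fun i _ => by
              have e5 : |∫ x, r n (x i, x i) ∂P| ≤ 1 := by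
                have := norm_integral_le_of_norm_le_const (μ := P) (C := 1)
                  (f := fun x : ι → Ω => r n (x i, x i)) (Eventually.of_forall fun z => hr1 n _)
                simpa using this
              have := abs_sub (∫ x, r n (x i, x i) ∂P) (∫ p, r n p ∂(μ.prod μ))
              linarith [hI1 n])
        _ = 2 * k := by simp [hk]; ring
    have e6 := abs_sub_abs_le_abs_sub (k ^ 2 * ∫ p, r n p ∂(μ.prod μ)) (∫ x, G n x ∂P)
    rw [abs_sub_comm, abs_mul, abs_of_nonneg (by positivity : (0:ℝ) ≤ k ^ 2)] at e6
    linarith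
  have hGle : ∀ x, weightedAbs N w (fun n => G n x) ≤ sampledMax N w h x := by
    intro x
    refine le_trans (le_of_eq ?_) (sampledSum_le_sampledMax N w h x
      (Finset.univ.filter fun i => x i ∈ S, Finset.univ.filter fun i => x i ∈ T))
    simp only [sampledSum, G]
    congr 1
    funext n
    rw [Finset.sum_filter]
    refine Finset.sum_congr rfl fun i _ => ?_
    rw [Finset.sum_filter]
    by_cases hi : x i ∈ S
    · rw [if_pos hi]
      refine Finset.sum_congr rfl fun j _ => ?_
      simp [r, Set.indicator, hi]
    · simp [r, hi]
  have hWi : Integrable (fun x => weightedAbs N w (fun n => G n x)) P :=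
    integrable_finsetSum _ fun n _ => (hGi n).abs.const_mul _
  calc k ^ 2 * weightedAbs N w (fun n => ∫ p in S ×ˢ T, h n p ∂(μ.prod μ))
      = ∑ n ∈ Finset.range N, w n * (k ^ 2 * |∫ p, r n p ∂(μ.prod μ)|) := by
        simp only [weightedAbs, hI, Finset.mul_sum]
        exact Finset.sum_congr rfl fun n _ => by ring
    _ ≤ ∑ n ∈ Finset.range N, w n * (|∫ x, G n x ∂P| + 2 * k) :=
        Finset.sum_le_sum fun n _ => mul_le_mul_of_nonneg_left (hEG n) (H.weight_nonneg n)
    _ = ∑ n ∈ Finset.range N, w n * |∫ x, G n x ∂P|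
        + (∑ n ∈ Finset.range N, w n) * (2 * k) := by
        rw [Finset.sum_mul, ← Finset.sum_add_distrib]
        exact Finset.sum_congr rfl fun n _ => by ring
    _ ≤ ∑ n ∈ Finset.range N, w n * ∫ x, |G n x| ∂P + 1 * (2 * k) := by
        refine add_le_add (Finset.sum_le_sum fun n _ => mul_le_mul_of_nonneg_left
          abs_integral_le_integral_abs (H.weight_nonneg n))
          (mul_le_mul_of_nonneg_right H.sum_weight_le (by positivity))
    _ = ∫ x, weightedAbs N w (fun n => G n x) ∂P + 2 * k := by
        simp only [weightedAbs, ← integral_const_mul]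
        rw [integral_finsetSum _ fun n _ => (hGi n).abs.const_mul _, one_mul]
    _ ≤ ∫ x, sampledMax N w h x ∂P + 2 * k :=
        add_le_add (integral_mono hWi H.integrable_sampledMax hGle) le_rfl

end Sampled

/-! ### McDiarmid's bounded differences inequality -/

section McDiarmid

open ProbabilityTheory

variable {Ω : Type*} [MeasurableSpace Ω]

lemma integrable_exp_mul_sub {α : Type*} [MeasurableSpace α] {ν : Measure α} [IsFiniteMeasure ν]
    {f : α → ℝ} (hf : Measurable f) {C : ℝ} (hC : ∀ x, |f x| ≤ C) (t m : ℝ) :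
    Integrable (fun x => Real.exp (t * (f x - m))) ν := by
  refine integrable_of_abs_le (C := Real.exp (|t| * (C + |m|))) (by fun_prop) fun x => ?_
  rw [abs_of_nonneg (Real.exp_pos _).le, Real.exp_le_exp]
  refine (le_abs_self _).trans ?_
  rw [abs_mul]
  exact mul_le_mul_of_nonneg_left ((abs_sub _ _).trans (by linarith [hC x])) (abs_nonneg t)

/-- **McDiarmid's inequality**: a function of independent random variables with bounded
differences is sub-Gaussian around its mean. -/
lemma hasSubgaussianMGF_of_bounded_differences (μ : Measure Ω) [IsProbabilityMeasure μ]
    (c : ℝ≥0) {n : ℕ} {f : (Fin n → Ω) → ℝ} (hf : Measurable f) {C : ℝ} (hC : ∀ x, |f x| ≤ C)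
    (hdiff : ∀ (i : Fin n) (x y : Fin n → Ω), (∀ j, j ≠ i → x j = y j) → f x ≤ f y + c) :
    HasSubgaussianMGF (fun x => f x - ∫ y, f y ∂(Measure.pi fun _ => μ)) (n * (c / 2) ^ 2)
      (Measure.pi fun _ : Fin n => μ) := by
  refine ⟨fun t => integrable_exp_mul_sub hf hC t _, fun t => ?_⟩
  induction n with
  | zero =>
    have h1 : ∀ x : Fin 0 → Ω, f x = f default := fun x => by rw [Subsingleton.elim x default]
    simp [mgf, h1]
  | succ n ih =>
    set P : Measure (Fin n → Ω) := Measure.pi fun _ => μ with hP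
    set Q : Measure (Fin (n + 1) → Ω) := Measure.pi fun _ => μ with hQ
    let e : Ω × (Fin n → Ω) → Fin (n + 1) → Ω := fun q => Fin.insertNth 0 q.1 q.2
    have he : MeasurePreserving e (μ.prod P) Q :=
      (measurePreserving_piFinSuccAbove (fun _ : Fin (n + 1) => μ) 0).symm
    have hem : Measurable fun q => f (e q) := hf.comp he.measurable
    let g : (Fin n → Ω) → ℝ := fun y => ∫ z, f (e (z, y)) ∂μ
    have hfi : ∀ y, Integrable (fun z => f (e (z, y))) μ := fun y =>
      integrable_of_abs_le (hem.comp (by fun_prop : Measurable fun z : Ω => (z, y))) fun _ => hC _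
    have hg : Measurable g := (hem.stronglyMeasurable.integral_prod_left (μ := μ)
      (f := fun z y => f (e (z, y)))).measurable
    have hgC : ∀ y, |g y| ≤ C := fun y => by
      have := norm_integral_le_of_norm_le_const (μ := μ) (C := C) (f := fun z => f (e (z, y)))
        (Eventually.of_forall fun z => hC _)
      simpa using this
    have hgdiff : ∀ (i : Fin n) (x y : Fin n → Ω), (∀ j, j ≠ i → x j = y j) → g x ≤ g y + c := by
      intro i x y hxy
      have h1 : g y + c = ∫ z, (f (e (z, y)) + c) ∂μ := by
        rw [integral_add (hfi y) (integrable_const _)]; simp [g]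
      rw [h1]
      refine integral_mono (hfi x) ((hfi y).add (integrable_const _)) fun z => ?_
      refine hdiff i.succ _ _ fun j hj => ?_
      induction j using Fin.cases with
      | zero => simp [e]
      | succ j => simpa [e] using hxy j fun h => hj (by rw [h])
    have hmean : ∫ x, f x ∂Q = ∫ y, g y ∂P := by
      rw [← integral_comp_measurePreserving he hf]
      exact integral_prod_symm _ (integrable_of_abs_le hem fun _ => hC _)
    have hinner : ∀ y, ∫ z, Real.exp (t * (f (e (z, y)) - g y)) ∂μ
        ≤ Real.exp ((c / 2) ^ 2 * t ^ 2 / 2) := by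
      intro y
      have hb : BddBelow (Set.range fun z => f (e (z, y))) :=
        ⟨-C, by rintro _ ⟨z, rfl⟩; exact (abs_le.1 (hC _)).1⟩
      have : Nonempty Ω := nonempty_of_isProbabilityMeasure μ
      have h1 := hasSubgaussianMGF_of_mem_Icc (μ := μ) (X := fun z => f (e (z, y)))
        (a := ⨅ z, f (e (z, y))) (b := (⨅ z, f (e (z, y))) + c)
        (hem.comp (by fun_prop : Measurable fun z : Ω => (z, y))).aemeasurable
        (Eventually.of_forall fun z => ⟨ciInf_le hb z, by
          rw [← sub_le_iff_le_add]
          refine le_ciInf fun z' => ?_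
          rw [sub_le_iff_le_add]
          refine hdiff 0 _ _ fun j hj => ?_
          induction j using Fin.cases with
          | zero => exact absurd rfl hj
          | succ j => simp [e]⟩)
      simpa [mgf, g] using h1.mgf_le t
    have hIg := integrable_exp_mul_sub (ν := P) hg hgC t (∫ y, g y ∂P)
    calc mgf (fun x => f x - ∫ y, f y ∂Q) Q t
        = ∫ y, ∫ z, Real.exp (t * (f (e (z, y)) - ∫ y, g y ∂P)) ∂μ ∂P := by
          rw [mgf, hmean, ← integral_comp_measurePreserving he (by fun_prop)]
          exact integral_prod_symm _ (integrable_exp_mul_sub hem (fun _ => hC _) t _)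
      _ = ∫ y, Real.exp (t * (g y - ∫ y, g y ∂P))
            * ∫ z, Real.exp (t * (f (e (z, y)) - g y)) ∂μ ∂P := by
          refine integral_congr_ae (Eventually.of_forall fun y => ?_)
          simp only [← integral_const_mul, ← Real.exp_add]
          exact integral_congr_ae (Eventually.of_forall fun z => by ring_nf)
      _ ≤ ∫ y, Real.exp (t * (g y - ∫ y, g y ∂P)) * Real.exp ((c / 2) ^ 2 * t ^ 2 / 2) ∂P := by
          refine integral_mono_of_nonneg (Eventually.of_forall fun y => ?_) (hIg.mul_const _)
            (Eventually.of_forall fun y => ?_)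
          · exact mul_nonneg (Real.exp_pos _).le (integral_nonneg fun z => (Real.exp_pos _).le)
          · exact mul_le_mul_of_nonneg_left (hinner y) (Real.exp_pos _).le
      _ = mgf (fun y => g y - ∫ y, g y ∂P) P t * Real.exp ((c / 2) ^ 2 * t ^ 2 / 2) := by
          rw [integral_mul_const, mgf]
      _ ≤ Real.exp (n * (c / 2) ^ 2 * t ^ 2 / 2) * Real.exp ((c / 2) ^ 2 * t ^ 2 / 2) := by
          refine mul_le_mul_of_nonneg_right ?_ (Real.exp_pos _).le
          simpa using ih hg hgC hgdiff
      _ = _ := by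
          rw [← Real.exp_add]; push_cast; ring_nf

end McDiarmid

/-! ### Moments of measure-valued kernels -/

section Moments

/-- A measurable measure-valued kernel with values of total mass at most one. -/
structure IsSubKernel {Z : Type*} [MeasurableSpace Z] (V : Sq → Measure Z) : Prop where
  measurable : Measurable V
  measure_univ_le : ∀ p, V p Set.univ ≤ 1

lemma IsProbGraphon.isSubKernel {Z : Type*} [MeasurableSpace Z] {W : Sq → Measure Z}
    (hW : IsProbGraphon W) : IsSubKernel W :=
  ⟨Measure.measurable_of_measurable_coe W hW.1, fun p => (hW.2 p).measure_univ.le⟩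

lemma IsSubKernel.isFiniteMeasure {Z : Type*} [MeasurableSpace Z] {V : Sq → Measure Z}
    (hV : IsSubKernel V) (p : Sq) : IsFiniteMeasure (V p) :=
  ⟨(hV.measure_univ_le p).trans_lt ENNReal.one_lt_top⟩

variable [OpensMeasurableSpace Z] {V U W : Sq → Measure Z}
  (f : BoundedContinuousFunction Z ℝ)

lemma IsSubKernel.measurable_integral (hV : IsSubKernel V) :
    Measurable fun p => ∫ z, f z ∂(V p) := by
  let κ : ProbabilityTheory.Kernel Sq Z := ⟨V, hV.measurable⟩
  have : ProbabilityTheory.IsFiniteKernel κ := ⟨1, ENNReal.one_lt_top, hV.measure_univ_le⟩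
  exact (f.continuous.measurable.stronglyMeasurable.integral_kernel (κ := κ)).measurable

lemma IsSubKernel.integral_mem_Icc (hV : IsSubKernel V) (hf : ∀ z, f z ∈ Set.Icc (0 : ℝ) 1)
    (p : Sq) : ∫ z, f z ∂(V p) ∈ Set.Icc (0 : ℝ) 1 := by
  have := hV.isFiniteMeasure p
  refine ⟨integral_nonneg fun z => (hf z).1, ?_⟩
  refine (integral_mono (f.integrable (V p)) (integrable_const 1) fun z => (hf z).2).trans ?_
  simpa [Measure.real] using ENNReal.toReal_mono ENNReal.one_ne_top (hV.measure_univ_le p)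

lemma IsSubKernel.integral_kernelInt (hV : IsSubKernel V) (A : Set Sq) :
    ∫ z, f z ∂(kernelInt V A) = ∫ p in A, ∫ z, f z ∂(V p) := by
  let κ : ProbabilityTheory.Kernel Sq Z := ⟨V, hV.measurable⟩
  have : ProbabilityTheory.IsFiniteKernel κ := ⟨1, ENNReal.one_lt_top, hV.measure_univ_le⟩
  exact ProbabilityTheory.Kernel.integral_comp (η := κ) (a := ())
    (κ := ProbabilityTheory.Kernel.const Unit ((volume : Measure Sq).restrict A))
    (f.integrable _)

/-- The differences of the moments of two kernels. -/
def momentDiff (F : ℕ → BoundedContinuousFunction Z ℝ) (U W : Sq → Measure Z) (n : ℕ) (p : Sq) :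
    ℝ :=
  ∫ z, F (n + 1) z ∂(U p) - ∫ z, F (n + 1) z ∂(W p)

/-- The weights `2^{-(n+1)}`. -/
def halfWeight (n : ℕ) : ℝ := (1 / 2) ^ (n + 1)

variable {F : ℕ → BoundedContinuousFunction Z ℝ}

lemma isKernelFamily_momentDiff (hF : IsConvDet F) (hU : IsSubKernel U) (hW : IsSubKernel W)
    (N : ℕ) : IsKernelFamily N halfWeight (momentDiff F U W) where
  weight_nonneg n := by unfold halfWeight; positivity
  sum_weight_le := by
    refine (summable_geometric_two.comp_injective (add_left_injective 1)).sum_le_tsum _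
      (fun n _ => by simp only [Function.comp]; positivity) |>.trans (le_of_eq ?_)
    have := summable_geometric_two.tsum_eq_zero_add
    rw [tsum_geometric_two] at this
    simp only [Function.comp]
    norm_num at this ⊢
    linarith
  measurable n := (hU.measurable_integral _).sub (hW.measurable_integral _)
  abs_le_one n p := by
    have h1 := hU.integral_mem_Icc (F (n + 1)) (hF.2.1 _) p
    have h2 := hW.integral_mem_Icc (F (n + 1)) (hF.2.1 _) p
    exact abs_le.2 ⟨by unfold momentDiff; linarith [h1.1, h2.2],
      by unfold momentDiff; linarith [h1.2, h2.1]⟩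

lemma abs_setIntegral_momentDiff_le (hF : IsConvDet F) (hU : IsSubKernel U)
    (hW : IsSubKernel W) (A : Set Sq) (n : ℕ) : |∫ p in A, momentDiff F U W n p| ≤ 1 := by
  have h1 := norm_setIntegral_le_of_norm_le_const (μ := volume) (s := A) (C := 1)
    (f := momentDiff F U W n) (measure_lt_top _ _)
    fun p _ => (isKernelFamily_momentDiff hF hU hW 0).abs_le_one n p
  rw [one_mul] at h1
  exact h1.trans measureReal_le_one

lemma hasSum_Fdist (hF : IsConvDet F) (hU : IsSubKernel U) (hW : IsSubKernel W)
    (hUW : ∀ p, U p Set.univ = W p Set.univ) (A : Set Sq) :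
    HasSum (fun n => halfWeight n * |∫ p in A, momentDiff F U W n p|)
      (Fdist F (kernelInt U A) (kernelInt W A)) := by
  have hdiff : ∀ n, ∫ z, F (n + 1) z ∂(kernelInt U A) - ∫ z, F (n + 1) z ∂(kernelInt W A)
      = ∫ p in A, momentDiff F U W n p := by
    intro n
    rw [hU.integral_kernelInt, hW.integral_kernelInt, ← integral_sub]
    · rfl
    all_goals
      refine integrable_of_abs_le (C := 1) (IsSubKernel.measurable_integral _ ‹_›) fun p => ?_
    · have := hU.integral_mem_Icc (F (n + 1)) (hF.2.1 _) p
      rw [abs_of_nonneg this.1]; exact this.2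
    · have := hW.integral_mem_Icc (F (n + 1)) (hF.2.1 _) p
      rw [abs_of_nonneg this.1]; exact this.2
  have hzero : ∫ z, F 0 z ∂(kernelInt U A) - ∫ z, F 0 z ∂(kernelInt W A) = 0 := by
    rw [hU.integral_kernelInt, hW.integral_kernelInt, hF.1]
    simp [Measure.real, hUW]
  have hsum : Summable fun n => halfWeight n * |∫ p in A, momentDiff F U W n p| := by
    refine Summable.of_nonneg_of_le (fun n => by unfold halfWeight; positivity) (fun n => ?_)
      (summable_geometric_two.comp_injective (add_left_injective 1))
    exact mul_le_of_le_one_right (by unfold halfWeight; positivity)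
      (abs_setIntegral_momentDiff_le hF hU hW A n)
  have h1 : (fun n => halfWeight n * |∫ p in A, momentDiff F U W n p|) = fun n =>
      (1 / 2 : ℝ) ^ (n + 1) *
        |∫ z, F (n + 1) z ∂(kernelInt U A) - ∫ z, F (n + 1) z ∂(kernelInt W A)| := by
    funext n; rw [hdiff, halfWeight]
  have h2 : Summable fun n => (1 / 2 : ℝ) ^ n *
      |∫ z, F n z ∂(kernelInt U A) - ∫ z, F n z ∂(kernelInt W A)| :=
    (summable_nat_add_iff 1).1 (h1 ▸ hsum)
  rw [Fdist, h2.tsum_eq_zero_add, hzero, abs_zero, mul_zero, zero_add, ← h1]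
  exact hsum.hasSum

lemma Fdist_le_weightedAbs_add (hF : IsConvDet F) (hU : IsSubKernel U) (hW : IsSubKernel W)
    (hUW : ∀ p, U p Set.univ = W p Set.univ) (A : Set Sq) (N : ℕ) :
    Fdist F (kernelInt U A) (kernelInt W A)
      ≤ weightedAbs N halfWeight (fun n => ∫ p in A, momentDiff F U W n p) + (1 / 2) ^ N := by
  have h := hasSum_Fdist hF hU hW hUW A
  rw [← h.tsum_eq, ← h.summable.sum_add_tsum_nat_add N]
  refine add_le_add le_rfl ?_
  have h1 : HasSum (fun n : ℕ => (1 / 2 : ℝ) ^ (N + 1) * (1 / 2) ^ n) ((1 / 2) ^ (N + 1) * 2) :=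
    hasSum_geometric_two.mul_left _
  have h2 : ((1 / 2 : ℝ)) ^ N = (1 / 2) ^ (N + 1) * 2 := by rw [pow_succ]; ring
  rw [h2, ← h1.tsum_eq]
  refine ((summable_nat_add_iff N).2 h.summable).tsum_le_tsum (fun n => ?_) h1.summable
  have h3 : halfWeight (n + N) = (1 / 2 : ℝ) ^ (N + 1) * (1 / 2) ^ n := by
    unfold halfWeight; ring
  rw [h3]
  exact mul_le_of_le_one_right (by positivity) (abs_setIntegral_momentDiff_le hF hU hW A _)

lemma weightedAbs_le_cutDistF (hF : IsConvDet F) (hU : IsSubKernel U) (hW : IsSubKernel W)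
    (hUW : ∀ p, U p Set.univ = W p Set.univ) (N : ℕ) {S T : Set unitInterval}
    (hS : MeasurableSet S) (hT : MeasurableSet T) :
    weightedAbs N halfWeight (fun n => ∫ p in S ×ˢ T, momentDiff F U W n p)
      ≤ cutDistF F U W := by
  have hbdd : BddAbove (Set.range fun ST :
      {p : Set unitInterval × Set unitInterval // MeasurableSet p.1 ∧ MeasurableSet p.2} =>
      Fdist F (kernelInt U (ST.val.1 ×ˢ ST.val.2)) (kernelInt W (ST.val.1 ×ˢ ST.val.2))) := by
    refine ⟨1, ?_⟩
    rintro _ ⟨ST, rfl⟩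
    simpa [weightedAbs] using Fdist_le_weightedAbs_add hF hU hW hUW (ST.val.1 ×ˢ ST.val.2) 0
  refine le_trans ?_ (le_ciSup hbdd ⟨(S, T), hS, hT⟩)
  have h := hasSum_Fdist hF hU hW hUW (S ×ˢ T)
  exact sum_le_hasSum _ (fun n _ => by unfold halfWeight; positivity) h

lemma cutDistF_le (hF : IsConvDet F) (hU : IsSubKernel U) (hW : IsSubKernel W)
    (hUW : ∀ p, U p Set.univ = W p Set.univ) (N : ℕ) {c : ℝ}
    (hc : ∀ S T : Set unitInterval, MeasurableSet S → MeasurableSet T →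
      weightedAbs N halfWeight (fun n => ∫ p in S ×ˢ T, momentDiff F U W n p) ≤ c) :
    cutDistF F U W ≤ c + (1 / 2) ^ N := by
  have : Nonempty
      {p : Set unitInterval × Set unitInterval // MeasurableSet p.1 ∧ MeasurableSet p.2} :=
    ⟨⟨(∅, ∅), MeasurableSet.empty, MeasurableSet.empty⟩⟩
  exact ciSup_le fun ST => (Fdist_le_weightedAbs_add hF hU hW hUW _ N).trans
    (add_le_add (hc _ _ ST.2.1 ST.2.2) le_rfl)

end Moments

/-! ### Step functions and sampled kernels -/

section Sample

lemma stepSet_eq_Ioc {k : ℕ} (hk : 0 < k) (i : Fin k) :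
    ∃ a b : unitInterval, stepSet k i = Set.Ioc a b ∧ (b : ℝ) - a = 1 / k := by
  have hk' : (0 : ℝ) < k := by exact_mod_cast hk
  have hi : (i : ℝ) + 1 ≤ k := by exact_mod_cast i.2
  refine ⟨⟨i / k, by positivity, (div_le_one hk').2 (by linarith)⟩,
    ⟨(i + 1) / k, by positivity, (div_le_one hk').2 hi⟩, ?_, ?_⟩
  · ext t
    simp [stepSet, ← Subtype.coe_lt_coe, ← Subtype.coe_le_coe]
  · ring

lemma measurableSet_stepSet {k : ℕ} (i : Fin k) : MeasurableSet (stepSet k i) := by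
  obtain ⟨a, b, h, -⟩ := stepSet_eq_Ioc i.pos i
  exact h ▸ measurableSet_Ioc

lemma volume_real_stepSet {k : ℕ} (i : Fin k) :
    (volume : Measure unitInterval).real (stepSet k i) = 1 / k := by
  obtain ⟨a, b, h, hab⟩ := stepSet_eq_Ioc i.pos i
  rw [h, Measure.real, unitInterval.volume_Ioc, hab, ENNReal.toReal_ofReal (by positivity)]

lemma eq_of_mem_stepSet {k : ℕ} {i j : Fin k} {t : unitInterval} (hi : t ∈ stepSet k i)
    (hj : t ∈ stepSet k j) : i = j := by
  have hk : (0 : ℝ) < k := by exact_mod_cast i.pos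
  obtain ⟨h1, h2⟩ := hi
  obtain ⟨h3, h4⟩ := hj
  have h5 : (i : ℝ) < j + 1 := (div_lt_div_iff_of_pos_right hk).1 (h1.trans_le h4)
  have h6 : (j : ℝ) < i + 1 := (div_lt_div_iff_of_pos_right hk).1 (h3.trans_le h2)
  norm_cast at h5 h6
  exact Fin.ext (by omega)

variable {k : ℕ}

lemma sum_indicator_stepSet_of_mem {M : Type*} [AddCommMonoid M] (c : Fin k → Fin k → M)
    {i j : Fin k} {p : Sq} (hp : p ∈ stepSet k i ×ˢ stepSet k j) :
    ∑ i', ∑ j', Set.indicator (stepSet k i' ×ˢ stepSet k j') (fun _ => c i' j') p = c i j := by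
  rw [Finset.sum_eq_single i, Finset.sum_eq_single j, Set.indicator_of_mem hp]
  · exact fun j' _ hj' =>
      Set.indicator_of_notMem (fun h => hj' (eq_of_mem_stepSet h.2 hp.2)) _
  · simp
  · exact fun i' _ hi' => Finset.sum_eq_zero fun j' _ =>
      Set.indicator_of_notMem (fun h => hi' (eq_of_mem_stepSet h.1 hp.1)) _
  · simp

lemma sum_indicator_stepSet_of_notMem {M : Type*} [AddCommMonoid M] (c : Fin k → Fin k → M)
    {p : Sq} (hp : ∀ i j, p ∉ stepSet k i ×ˢ stepSet k j) :
    ∑ i, ∑ j, Set.indicator (stepSet k i ×ˢ stepSet k j) (fun _ => c i j) p = 0 :=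
  Finset.sum_eq_zero fun i _ => Finset.sum_eq_zero fun j _ => Set.indicator_of_notMem (hp i j) _

lemma exists_sample_eq {Z : Type*} [MeasurableSpace Z] (x : Fin k → unitInterval) (p : Sq) :
    (∃ q, ∀ V : Sq → Measure Z, sample V x p = V q) ∨ ∀ V : Sq → Measure Z, sample V x p = 0 := by
  by_cases hp : ∃ i j, p ∈ stepSet k i ×ˢ stepSet k j
  · obtain ⟨i, j, hp⟩ := hp
    exact Or.inl ⟨(x i, x j), fun V => sum_indicator_stepSet_of_mem _ hp⟩
  · push Not at hp
    exact Or.inr fun V => sum_indicator_stepSet_of_notMem _ hp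

lemma IsSubKernel.sample {Z : Type*} [MeasurableSpace Z] {V : Sq → Measure Z}
    (hV : IsSubKernel V) (x : Fin k → unitInterval) : IsSubKernel (sample V x) where
  measurable := by
    refine Finset.measurable_fun_sum _ fun i _ => Finset.measurable_fun_sum _ fun j _ => ?_
    exact measurable_const.indicator ((measurableSet_stepSet i).prod (measurableSet_stepSet j))
  measure_univ_le p := by
    obtain ⟨q, h⟩ | h := exists_sample_eq (Z := Z) x p
    · exact h V ▸ hV.measure_univ_le q
    · simp [h V]

lemma sample_univ_eq {Z : Type*} [MeasurableSpace Z] {U W : Sq → Measure Z}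
    (hUW : ∀ p, U p Set.univ = W p Set.univ) (x : Fin k → unitInterval) (p : Sq) :
    sample U x p Set.univ = sample W x p Set.univ := by
  obtain ⟨q, h⟩ | h := exists_sample_eq (Z := Z) x p
  · rw [h, h, hUW]
  · rw [h, h]

lemma momentDiff_sample (F : ℕ → BoundedContinuousFunction Z ℝ) (U W : Sq → Measure Z)
    (x : Fin k → unitInterval) (n : ℕ) (p : Sq) :
    momentDiff F (sample U x) (sample W x) n p = ∑ i, ∑ j,
      Set.indicator (stepSet k i ×ˢ stepSet k j) (fun _ => momentDiff F U W n (x i, x j)) p := by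
  by_cases hp : ∃ i j, p ∈ stepSet k i ×ˢ stepSet k j
  · obtain ⟨i, j, hp⟩ := hp
    rw [sum_indicator_stepSet_of_mem _ hp, momentDiff, sample, sample,
      sum_indicator_stepSet_of_mem _ hp, sum_indicator_stepSet_of_mem _ hp, momentDiff]
  · push Not at hp
    rw [sum_indicator_stepSet_of_notMem _ hp, momentDiff, sample, sample,
      sum_indicator_stepSet_of_notMem _ hp, sum_indicator_stepSet_of_notMem _ hp, sub_self]

lemma setIntegral_momentDiff_sample (F : ℕ → BoundedContinuousFunction Z ℝ)
    (U W : Sq → Measure Z) (x : Fin k → unitInterval) (n : ℕ) (S T : Set unitInterval) :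
    ∫ p in S ×ˢ T, momentDiff F (sample U x) (sample W x) n p
      = ∑ i, (volume : Measure unitInterval).real (stepSet k i ∩ S) *
          ∑ j, (volume : Measure unitInterval).real (stepSet k j ∩ T) *
            momentDiff F U W n (x i, x j) := by
  have hm : ∀ i j : Fin k, MeasurableSet (stepSet k i ×ˢ stepSet k j) := fun i j =>
    (measurableSet_stepSet i).prod (measurableSet_stepSet j)
  have hintg : ∀ i j : Fin k, Integrable (Set.indicator (stepSet k i ×ˢ stepSet k j)
      fun _ => momentDiff F U W n (x i, x j)) ((volume : Measure Sq).restrict (S ×ˢ T)) :=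
    fun i j => (integrable_const _).indicator (hm i j)
  simp_rw [momentDiff_sample]
  rw [integral_finsetSum _ fun i _ => integrable_finsetSum _ fun j _ => hintg i j]
  refine Finset.sum_congr rfl fun i _ => ?_
  rw [integral_finsetSum _ fun j _ => hintg i j, Finset.mul_sum]
  refine Finset.sum_congr rfl fun j _ => ?_
  rw [integral_indicator_const _ (hm i j), measureReal_restrict_apply (hm i j),
    Set.prod_inter_prod, Measure.volume_eq_prod, measureReal_prod_prod, smul_eq_mul, mul_assoc]

lemma weightedAbs_const_mul (N : ℕ) (w a : ℕ → ℝ) {c : ℝ} (hc : 0 ≤ c) :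
    weightedAbs N w (fun n => c * a n) = c * weightedAbs N w a := by
  rw [weightedAbs, weightedAbs, Finset.mul_sum]
  refine Finset.sum_congr rfl fun n _ => ?_
  rw [abs_mul, abs_of_nonneg hc]
  ring

lemma exists_weightedAbs_le_sum_subset {ι : Type*} [Fintype ι] (N : ℕ) {w : ℕ → ℝ}
    (hw : ∀ n, 0 ≤ w n) (g : ℕ → ι → ℝ) {a : ι → ℝ} (ha : ∀ i, a i ∈ Set.Icc (0 : ℝ) 1) :
    ∃ S : Finset ι, weightedAbs N w (fun n => ∑ i, a i * g n i)
      ≤ weightedAbs N w (fun n => ∑ i ∈ S, g n i) := by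
  classical
  have hconv : ConvexOn ℝ Set.univ
      (fun b : ι → ℝ => weightedAbs N w (fun n => ∑ i, b i * g n i)) := by
    refine ⟨convex_univ, fun b _ c _ s t hs ht _ => ?_⟩
    simp only [weightedAbs, smul_eq_mul, Finset.mul_sum]
    rw [← Finset.sum_add_distrib]
    refine Finset.sum_le_sum fun n _ => ?_
    have h1 : ∑ i, (s • b + t • c) i * g n i
        = s * ∑ i, b i * g n i + t * ∑ i, c i * g n i := by
      simp only [Finset.mul_sum, ← Finset.sum_add_distrib, Pi.add_apply, Pi.smul_apply,
        smul_eq_mul]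
      exact Finset.sum_congr rfl fun i _ => by ring
    rw [h1]
    have h2 := abs_add_le (s * ∑ i, b i * g n i) (t * ∑ i, c i * g n i)
    rw [abs_mul, abs_mul, abs_of_nonneg hs, abs_of_nonneg ht] at h2
    exact (mul_le_mul_of_nonneg_left h2 (hw n)).trans (le_of_eq (by ring))
  have hmem : a ∈ convexHull ℝ (Set.univ.pi fun _ : ι => ({0, 1} : Set ℝ)) := by
    rw [convexHull_pi]
    intro i _
    rw [convexHull_pair, segment_eq_Icc zero_le_one]
    exact ha i
  obtain ⟨b, hb, hab⟩ := hconv.exists_ge_of_mem_convexHull (Set.subset_univ _) hmem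
  refine ⟨Finset.univ.filter fun i => b i = 1, hab.trans (le_of_eq ?_)⟩
  congr 1
  funext n
  rw [Finset.sum_filter]
  refine Finset.sum_congr rfl fun i _ => ?_
  obtain h | h := hb i trivial
  · simp [h]
  · simp [Set.mem_singleton_iff.1 h]

lemma exists_weightedAbs_bilinear_le {ι : Type*} [Fintype ι] (N : ℕ) {w : ℕ → ℝ}
    (hw : ∀ n, 0 ≤ w n) (g : ℕ → ι → ι → ℝ) {a b : ι → ℝ} (ha : ∀ i, a i ∈ Set.Icc (0 : ℝ) 1)
    (hb : ∀ i, b i ∈ Set.Icc (0 : ℝ) 1) :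
    ∃ S T : Finset ι, weightedAbs N w (fun n => ∑ i, a i * ∑ j, b j * g n i j)
      ≤ weightedAbs N w (fun n => ∑ i ∈ S, ∑ j ∈ T, g n i j) := by
  obtain ⟨S, hS⟩ := exists_weightedAbs_le_sum_subset N hw
    (fun n i => ∑ j, b j * g n i j) ha
  obtain ⟨T, hT⟩ := exists_weightedAbs_le_sum_subset N hw (fun n j => ∑ i ∈ S, g n i j) hb
  have h1 : ∀ n, ∑ i ∈ S, ∑ j, b j * g n i j = ∑ j, b j * ∑ i ∈ S, g n i j := fun n => by
    simp only [Finset.mul_sum]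
    exact Finset.sum_comm
  refine ⟨S, T, hS.trans ?_⟩
  simpa only [h1, Finset.sum_comm (s := S)] using hT

variable [OpensMeasurableSpace Z] {F : ℕ → BoundedContinuousFunction Z ℝ} {U W : Sq → Measure Z}

lemma cutDistF_sample_le (hF : IsConvDet F) (hU : IsSubKernel U) (hW : IsSubKernel W)
    (hUW : ∀ p, U p Set.univ = W p Set.univ) (hk : 0 < k) (N : ℕ) (x : Fin k → unitInterval) :
    cutDistF F (sample U x) (sample W x)
      ≤ sampledMax N halfWeight (momentDiff F U W) x / k ^ 2 + (1 / 2) ^ N := by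
  have hk' : (0 : ℝ) < k := by exact_mod_cast hk
  refine cutDistF_le hF (hU.sample x) (hW.sample x) (sample_univ_eq hUW x) N fun S T _ _ => ?_
  have hfrac : ∀ (S : Set unitInterval) (i : Fin k),
      k * (volume : Measure unitInterval).real (stepSet k i ∩ S) ∈ Set.Icc (0 : ℝ) 1 := by
    refine fun S i => ⟨by positivity, ?_⟩
    calc k * (volume : Measure unitInterval).real (stepSet k i ∩ S)
        ≤ k * (1 / k) := by
          rw [← volume_real_stepSet i]
          exact mul_le_mul_of_nonneg_left (measureReal_mono Set.inter_subset_left) hk'.le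
      _ = 1 := by field_simp
  obtain ⟨A, B, hAB⟩ := exists_weightedAbs_bilinear_le N (w := halfWeight)
    (isKernelFamily_momentDiff hF hU hW N).weight_nonneg
    (fun n i j => momentDiff F U W n (x i, x j)) (hfrac S) (hfrac T)
  rw [le_div_iff₀ (by positivity), mul_comm, ← weightedAbs_const_mul _ _ _ (by positivity)]
  refine le_trans (le_of_eq ?_) (hAB.trans (sampledSum_le_sampledMax N halfWeight _ x (A, B)))
  congr 1
  funext n
  rw [setIntegral_momentDiff_sample]
  simp only [Finset.mul_sum]
  exact Finset.sum_congr rfl fun i _ => Finset.sum_congr rfl fun j _ => by ring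

lemma volume_real_stepSet_inter_iUnion (A : Finset (Fin k)) (i : Fin k) :
    (volume : Measure unitInterval).real (stepSet k i ∩ ⋃ j ∈ A, stepSet k j)
      = if i ∈ A then 1 / (k : ℝ) else 0 := by
  split_ifs with hi
  · rw [Set.inter_eq_left.2 (Set.subset_iUnion₂ (s := fun j (_ : j ∈ A) => stepSet k j) i hi),
      volume_real_stepSet]
  · suffices stepSet k i ∩ ⋃ j ∈ A, stepSet k j = ∅ by simp [this]
    refine Set.eq_empty_of_forall_notMem fun t ht => ?_
    obtain ⟨j, hj, htj⟩ := Set.mem_iUnion₂.1 ht.2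
    exact hi (eq_of_mem_stepSet ht.1 htj ▸ hj)

lemma sampledMax_div_le_cutDistF_sample (hF : IsConvDet F) (hU : IsSubKernel U)
    (hW : IsSubKernel W) (hUW : ∀ p, U p Set.univ = W p Set.univ) (hk : 0 < k) (N : ℕ)
    (x : Fin k → unitInterval) :
    sampledMax N halfWeight (momentDiff F U W) x / k ^ 2
      ≤ cutDistF F (sample U x) (sample W x) := by
  have hk' : (0 : ℝ) < k := by exact_mod_cast hk
  rw [div_le_iff₀ (by positivity)]
  refine ciSup_le fun ST => ?_
  have hm : ∀ A : Finset (Fin k), MeasurableSet (⋃ j ∈ A, stepSet k j) := fun A =>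
    A.measurableSet_biUnion fun i _ => measurableSet_stepSet i
  have h := weightedAbs_le_cutDistF hF (hU.sample x) (hW.sample x) (sample_univ_eq hUW x) N
    (hm ST.1) (hm ST.2)
  rw [mul_comm]
  refine le_trans (le_of_eq ?_) (mul_le_mul_of_nonneg_left h (by positivity : (0 : ℝ) ≤ k ^ 2))
  rw [← weightedAbs_const_mul _ _ _ (by positivity), sampledSum]
  congr 1
  funext n
  rw [setIntegral_momentDiff_sample]
  simp only [volume_real_stepSet_inter_iUnion, ite_mul, zero_mul, Finset.sum_ite_mem,
    Finset.univ_inter]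
  simp only [Finset.mul_sum]
  refine Finset.sum_congr rfl fun i _ => Finset.sum_congr rfl fun j _ => ?_
  field_simp

end Sample

/-! ### Concentration and the sampling lemma -/

section Concentration

lemma IsKernelFamily.measureReal_abs_sampledMax_sub_ge_le {Ω : Type*} [MeasurableSpace Ω]
    {N : ℕ} {w : ℕ → ℝ} {h : ℕ → Ω × Ω → ℝ} (H : IsKernelFamily N w h) (μ : Measure Ω)
    [IsProbabilityMeasure μ] (k : ℕ) {t : ℝ} (ht : 0 ≤ t) :
    (Measure.pi fun _ : Fin k => μ).real
      {x | t ≤ |sampledMax N w h x - ∫ y, sampledMax N w h y ∂Measure.pi fun _ : Fin k => μ|}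
      ≤ 2 * Real.exp (-t ^ 2 / (8 * k ^ 3)) := by
  have hsub := hasSubgaussianMGF_of_bounded_differences μ (4 * k : ℝ≥0)
    (f := fun x : Fin k → Ω => sampledMax N w h x) H.measurable_sampledMax
    H.abs_sampledMax_le fun i x y hxy => by
      simpa using H.sampledMax_le_add i hxy
  have hexp : -t ^ 2 / (2 * ((k * (4 * k / 2) ^ 2 : ℝ≥0) : ℝ)) = -t ^ 2 / (8 * k ^ 3) := by
    congr 1
    push_cast
    ring
  have h1 := hsub.measure_ge_le ht
  have h2 := hsub.neg.measure_ge_le ht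
  rw [hexp] at h1 h2
  refine (measureReal_mono fun x hx => ?_).trans ((measureReal_union_le _ _).trans
    ((add_le_add h1 h2).trans (two_mul _).ge))
  exact le_abs.1 (Set.mem_ofPred_eq ▸ hx)

/-- The numerical inequality behind the trivial range of the sampling lemma. -/
lemma one_le_four_mul_mul_exp {q : ℝ} (h1 : 1 ≤ q) (h2 : q ≤ 2) :
    1 ≤ 4 * q * Real.exp (-q ^ 2 / 10) := by
  have h3 := Real.add_one_le_exp (-q ^ 2 / 10)
  have h4 : (1 : ℝ) / 4 ≤ Real.exp (-q ^ 2 / 10) := by nlinarith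
  nlinarith

lemma sub_bounds_of_deviation {q M E D d ε : ℝ} (hq : 2 < q) (hε : ε ≤ 1 / q ^ 4)
    (hDM : D ≤ M / (q ^ 4) ^ 2 + ε) (hMD : M / (q ^ 4) ^ 2 ≤ D)
    (hEd : E ≤ (q ^ 4) ^ 2 * d + 8 * (q ^ 4 * q ^ 2) + q ^ 4)
    (hdE : d ≤ (E + 2 * q ^ 4) / (q ^ 4) ^ 2 + ε)
    (hME : |M - E| < q ^ 7) : -(2 / q) ≤ D - d ∧ D - d ≤ 9 / q := by
  have hq0 : 0 < q := by linarith
  obtain ⟨h1, h2⟩ := abs_lt.1 hME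
  have e1 : q ^ 7 / (q ^ 4) ^ 2 = 1 / q := by field_simp
  have e2 : (E + 2 * q ^ 4) / (q ^ 4) ^ 2 = E / (q ^ 4) ^ 2 + 2 / q ^ 4 := by field_simp
  have e3 : ((q ^ 4) ^ 2 * d + 8 * (q ^ 4 * q ^ 2) + q ^ 4) / (q ^ 4) ^ 2
      = d + 8 / q ^ 2 + 1 / q ^ 4 := by field_simp
  have h3 : (M - E) / (q ^ 4) ^ 2 ≤ 1 / q := by
    rw [← e1]; gcongr
  have h4 : (E - M) / (q ^ 4) ^ 2 ≤ 1 / q := by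
    rw [← e1]; gcongr; linarith
  have h5 : E / (q ^ 4) ^ 2 ≤ d + 8 / q ^ 2 + 1 / q ^ 4 := by
    rw [← e3]; gcongr
  have h6 : 1 / q ^ 2 ≤ 1 / 2 * (1 / q) := by
    rw [one_div_mul_one_div]; apply one_div_le_one_div_of_le <;> nlinarith
  have h7 : 1 / q ^ 4 ≤ 1 / 8 * (1 / q) := by
    rw [one_div_mul_one_div]
    refine one_div_le_one_div_of_le (by positivity) ?_
    have : 8 ≤ q ^ 3 := by nlinarith [pow_le_pow_left₀ zero_le_two hq.le 3]
    nlinarith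
  have f1 : (2 : ℝ) / q = 2 * (1 / q) := by ring
  have f2 : (9 : ℝ) / q = 9 * (1 / q) := by ring
  have f3 : (2 : ℝ) / q ^ 4 = 2 * (1 / q ^ 4) := by ring
  have f4 : (8 : ℝ) / q ^ 2 = 8 * (1 / q ^ 2) := by ring
  have h8 : 0 < 1 / q := by positivity
  rw [sub_div] at h3 h4
  constructor <;> linarith

end Concentration

/-- **First Sampling Lemma.**
Let `F` be a convergence determining sequence, let `U, W` be probability-graphons,
`k ∈ ℕ*`, and let `X = (X₁, …, X_k)` be uniformly distributed on `[0,1]^k`.  Then with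
probability at least `1 − 4 k^{1/4} e^{−√k/10}` one has
`−2/k^{1/4} ≤ ‖U_X − W_X‖_{□,F} − ‖U − W‖_{□,F} ≤ 9/k^{1/4}`
(recall that `‖U − W‖_{□,F} = d_{□,F}(U, W)`). -/
theorem first_sampling_lemma
    {Z : Type*} [MeasurableSpace Z] [TopologicalSpace Z] [PolishSpace Z] [BorelSpace Z]
    (F : ℕ → BoundedContinuousFunction Z ℝ) (hF : IsConvDet F)
    (U W : Sq → Measure Z) (hU : IsProbGraphon U) (hW : IsProbGraphon W)
    (k : ℕ) (hk : 1 ≤ k) :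
    ENNReal.ofReal (1 - 4 * (k : ℝ) ^ ((1:ℝ)/4) * Real.exp (-Real.sqrt k / 10)) ≤
      (volume : Measure (Fin k → unitInterval))
        {x | -(2 / (k : ℝ) ^ ((1:ℝ)/4)) ≤
              cutDistF F (sample U x) (sample W x) - cutDistF F U W ∧
            cutDistF F (sample U x) (sample W x) - cutDistF F U W ≤
              9 / (k : ℝ) ^ ((1:ℝ)/4)} := by
  have hUW : ∀ p, U p Set.univ = W p Set.univ := fun p => by
    rw [(hU.2 p).measure_univ, (hW.2 p).measure_univ]
  have hk1 : (1 : ℝ) ≤ k := by exact_mod_cast hk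
  set q : ℝ := (k : ℝ) ^ ((1 : ℝ) / 4) with hq
  have hq1 : 1 ≤ q := Real.one_le_rpow hk1 (by norm_num)
  have hqk : (k : ℝ) = q ^ 4 := by
    rw [hq, ← Real.rpow_natCast, ← Real.rpow_mul (by positivity)]
    norm_num
  have hsqrt : √(k : ℝ) = q ^ 2 := by
    rw [hqk, show q ^ 4 = (q ^ 2) ^ 2 by ring, Real.sqrt_sq (by positivity)]
  rw [hsqrt]
  obtain hq2 | hq2 := le_or_gt q 2
  · rw [ENNReal.ofReal_of_nonpos (by linarith [one_le_four_mul_mul_exp hq1 hq2])]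
    exact zero_le
  have hU' := hU.isSubKernel
  have hW' := hW.isSubKernel
  have H := isKernelFamily_momentDiff hF hU' hW' k
  set P : Measure (Fin k → unitInterval) := volume with hP
  set M : (Fin k → unitInterval) → ℝ := sampledMax k halfWeight (momentDiff F U W) with hM
  have hpow : ((1 : ℝ) / 2) ^ k ≤ 1 / q ^ 4 := by
    rw [← hqk, one_div_pow]
    exact one_div_le_one_div_of_le (by positivity) (by exact_mod_cast Nat.lt_two_pow_self.le)
  have hup : ∫ x, M x ∂P ≤ (q ^ 4) ^ 2 * cutDistF F U W + 8 * (q ^ 4 * q ^ 2) + q ^ 4 := by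
    have := H.integral_sampledMax_le (ι := Fin k) volume
      fun S T hS hT => weightedAbs_le_cutDistF hF hU' hW' hUW k hS hT
    rwa [Fintype.card_fin, hsqrt, hqk] at this
  have hlow : cutDistF F U W ≤ (∫ x, M x ∂P + 2 * q ^ 4) / (q ^ 4) ^ 2 + (1 / 2) ^ k := by
    refine cutDistF_le hF hU' hW' hUW k fun S T hS hT => ?_
    have := H.weightedAbs_le_integral_sampledMax (ι := Fin k) volume hS hT
    rw [Fintype.card_fin, hqk] at this
    rw [le_div_iff₀ (by positivity), mul_comm]
    exact this
  have hconc : P.real {x | q ^ 7 ≤ |M x - ∫ y, M y ∂P|} ≤ 4 * q * Real.exp (-q ^ 2 / 10) := by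
    refine (H.measureReal_abs_sampledMax_sub_ge_le volume k (by positivity)).trans ?_
    have h1 : -(q ^ 7) ^ 2 / (8 * (k : ℝ) ^ 3) = -q ^ 2 / 8 := by
      rw [hqk]
      field_simp
    rw [h1]
    refine mul_le_mul (by linarith) (Real.exp_le_exp.2 ?_) (Real.exp_pos _).le (by linarith)
    linarith [sq_nonneg q]
  have hmeas : MeasurableSet {x | q ^ 7 ≤ |M x - ∫ y, M y ∂P|} :=
    measurableSet_le measurable_const (H.measurable_sampledMax.sub measurable_const).abs
  have hcompl := probReal_compl_eq_one_sub (μ := P) hmeas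
  refine (ENNReal.ofReal_le_ofReal (q := P.real {x | q ^ 7 ≤ |M x - ∫ y, M y ∂P|}ᶜ)
    (by linarith)).trans ?_
  rw [ofReal_measureReal]
  refine measure_mono fun x hx => ?_
  refine sub_bounds_of_deviation hq2 hpow (M := M x) ?_ ?_ hup hlow (not_le.1 hx)
  · rw [← hqk]
    exact cutDistF_sample_le hF hU' hW' hUW hk k x
  · rw [← hqk]
    exact sampledMax_div_le_cutDistF_sample hF hU' hW' hUW hk k x

end PG
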